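/- arXiv:1802.05016 — 5 statements merged into one kernel-verified Lean document; each statement's English description precedes it below -/
import Mathlib

section
/- Under the bounded-density assumption on δ, for every N ≥ 1, Var(H(Ê_N(Y)) − H(E[X|Y])) ≤ E[(H(Ê_N(Y)) − H(E[X|Y]))²] ≤ 2ρ₀·N^{-1/2} + δ₀^{-2}·N^{-1}; in particular this variance is O(N^{-1/2}). -/
open MeasureTheory ProbabilityTheory
open scoped ENNReal

/-- The Heaviside step function: `H(x) = 1` for `x ≥ 0` and `0` otherwise. -/
noncomputable def heaviside (x : ℝ) : ℝ := if 0 ≤ x then 1 else 0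

theorem measurable_heaviside : Measurable heaviside :=
  Measurable.ite measurableSet_Ici measurable_const measurable_const

theorem heaviside_sub_sq_le_one (a b : ℝ) : (heaviside a - heaviside b) ^ 2 ≤ 1 := by
  unfold heaviside
  split_ifs <;> norm_num

/-- The Heaviside values of `a` and `b` can only differ if `a` is at distance at least `|b|`
from `b`. -/
theorem heaviside_sub_sq_le_indicator (a b : ℝ) :
    (heaviside a - heaviside b) ^ 2 ≤ if |b| ≤ |a - b| then 1 else 0 := by
  split_ifs with h
  · exact heaviside_sub_sq_le_one a b
  · rw [not_le] at h
    have hab : heaviside a = heaviside b := by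
      unfold heaviside
      rcases le_or_gt 0 b with hb | hb
      · rw [abs_of_nonneg hb, abs_lt] at h
        rw [if_pos (by linarith), if_pos hb]
      · rw [abs_of_neg hb, abs_lt] at h
        rw [if_neg (by linarith), if_neg (by linarith)]
    simp [hab]

/-- Chebyshev's inequality for the mean of `N` independent samples of a law `P` with mean `b`. -/
theorem measure_pi_abs_le_abs_mean_sub_le (P : Measure ℝ) [IsProbabilityMeasure P]
    (hP : Integrable (fun x => x ^ 2) P) {b : ℝ} (hb : b = ∫ t, t ∂P) (hb0 : b ≠ 0)
    {N : ℕ} (hN : 1 ≤ N) :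
    (Measure.pi fun _ : Fin N => P) {x | |b| ≤ |(∑ n, x n) / (N : ℝ) - b|}
      ≤ ENNReal.ofReal (variance (fun t => t) P / (N * b ^ 2)) := by
  have hN0 : (0 : ℝ) < N := by exact_mod_cast hN
  have hL2 : MemLp (fun t : ℝ => t) 2 P :=
    (memLp_two_iff_integrable_sq measurable_id.aestronglyMeasurable).2 hP
  have hsumL2 : MemLp (∑ n, fun x : Fin N → ℝ => x n) 2 (Measure.pi fun _ : Fin N => P) :=
    memLp_finsetSum' _ fun n _ =>
      hL2.comp_measurePreserving (measurePreserving_eval (fun _ : Fin N => P) n)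
  have hmean : ∫ x, (∑ n, fun x : Fin N → ℝ => x n) x ∂(Measure.pi fun _ : Fin N => P)
      = N * b := by
    simp only [Finset.sum_apply]
    rw [integral_finsetSum _ fun n _ =>
      integrable_comp_eval (μ := fun _ : Fin N => P) (hL2.integrable one_le_two)]
    have heval (n : Fin N) : ∫ x : Fin N → ℝ, x n ∂(Measure.pi fun _ : Fin N => P) = b := by
      rw [hb]
      exact integral_comp_eval (μ := fun _ : Fin N => P) (f := fun t : ℝ => t)
        hL2.aestronglyMeasurable
    simp [heval]
  have hvar : variance (∑ n, fun x : Fin N → ℝ => x n) (Measure.pi fun _ : Fin N => P)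
      = N * variance (fun t => t) P := by
    rw [variance_sum_pi (μ := fun _ : Fin N => P) (X := fun _ t => t) fun _ => hL2]
    simp
  have hcheb := meas_ge_le_variance_div_sq hsumL2 (c := N * |b|) (by positivity)
  rw [hmean, hvar] at hcheb
  refine (measure_mono fun x hx => ?_).trans (hcheb.trans_eq ?_)
  · simp only [Set.mem_ofPred_eq, Finset.sum_apply] at hx ⊢
    have hscale : (∑ n, x n) - N * b = N * ((∑ n, x n) / (N : ℝ) - b) := by
      field_simp
    rw [hscale, abs_mul, abs_of_pos hN0]
    gcongr
  · congr 1
    rw [mul_pow, sq_abs]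
    field_simp

theorem lintegral_Ioi_min_one_inv_sq_le {a : ℝ} (ha : 0 < a) :
    ∫⁻ t in Set.Ioi (0 : ℝ), ENNReal.ofReal (min 1 (1 / (a * t ^ 2)))
      ≤ ENNReal.ofReal (2 * a ^ (-(1 : ℝ) / 2)) := by
  set c : ℝ := a ^ (-(1 : ℝ) / 2) with hc
  have hc0 : 0 < c := Real.rpow_pos_of_pos ha _
  have hac : a⁻¹ = c * c := by
    rw [hc, ← Real.rpow_add ha]
    norm_num [Real.rpow_neg_one]
  rw [← Set.Ioc_union_Ioi_eq_Ioi hc0.le, two_mul, ENNReal.ofReal_add hc0.le hc0.le]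
  refine (lintegral_union_le _ _ _).trans (add_le_add ?_ ?_)
  · calc ∫⁻ t in Set.Ioc 0 c, ENNReal.ofReal (min 1 (1 / (a * t ^ 2)))
        ≤ ∫⁻ _ in Set.Ioc 0 c, 1 :=
          lintegral_mono fun t => ENNReal.ofReal_le_one.2 (min_le_left _ _)
      _ = ENNReal.ofReal c := by simp
  · calc ∫⁻ t in Set.Ioi c, ENNReal.ofReal (min 1 (1 / (a * t ^ 2)))
        ≤ ∫⁻ t in Set.Ioi c, ENNReal.ofReal (a⁻¹ * t ^ (-2 : ℝ)) := by
          refine setLIntegral_mono' measurableSet_Ioi fun t ht => ?_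
          refine ENNReal.ofReal_le_ofReal ((min_le_right _ _).trans_eq ?_)
          rw [Real.rpow_neg (hc0.trans ht).le, Real.rpow_two, one_div, mul_inv]
      _ = ENNReal.ofReal (∫ t in Set.Ioi c, a⁻¹ * t ^ (-2 : ℝ)) := by
          refine (ofReal_integral_eq_lintegral_ofReal
            ((integrableOn_Ioi_rpow_of_lt (by norm_num) hc0).const_mul _) ?_).symm
          filter_upwards [ae_restrict_mem measurableSet_Ioi] with t ht
          have : 0 < t := hc0.trans ht
          simp only [Pi.zero_apply]
          positivity
      _ = ENNReal.ofReal c := by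
          rw [integral_const_mul, integral_Ioi_rpow_of_lt (by norm_num) hc0, hac]
          norm_num [Real.rpow_neg_one]

theorem lintegral_min_one_inv_sq_le (P : Measure ℝ) [IsProbabilityMeasure P]
    {ρ : ℝ → ℝ} {ρ₀ δ₀ a : ℝ} (hρ₀ : 0 < ρ₀) (hδ₀ : 0 < δ₀) (ha : 0 < a)
    (hP : P = volume.withDensity fun t => ENNReal.ofReal (ρ t))
    (hρbound : ∀ t ∈ Set.Icc (0 : ℝ) δ₀, ρ t ≤ ρ₀) :
    ∫⁻ t in Set.Ioi (0 : ℝ), ENNReal.ofReal (min 1 (1 / (a * t ^ 2))) ∂P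
      ≤ ENNReal.ofReal (2 * ρ₀ * a ^ (-(1 : ℝ) / 2) + δ₀ ^ (-(2 : ℝ)) * a⁻¹) := by
  have hrestrict : P.restrict (Set.Ioc 0 δ₀)
      ≤ ENNReal.ofReal ρ₀ • volume.restrict (Set.Ioc 0 δ₀) := by
    rw [hP, restrict_withDensity measurableSet_Ioc, ← withDensity_const]
    refine withDensity_mono ?_
    filter_upwards [ae_restrict_mem measurableSet_Ioc] with t ht
    exact ENNReal.ofReal_le_ofReal (hρbound t (Set.Ioc_subset_Icc_self ht))
  rw [← Set.Ioc_union_Ioi_eq_Ioi hδ₀.le, ENNReal.ofReal_add (by positivity) (by positivity)]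
  refine (lintegral_union_le _ _ _).trans (add_le_add ?_ ?_)
  · calc ∫⁻ t in Set.Ioc 0 δ₀, ENNReal.ofReal (min 1 (1 / (a * t ^ 2))) ∂P
        ≤ ∫⁻ t, ENNReal.ofReal (min 1 (1 / (a * t ^ 2)))
            ∂(ENNReal.ofReal ρ₀ • volume.restrict (Set.Ioc 0 δ₀)) :=
          lintegral_mono' hrestrict le_rfl
      _ = ENNReal.ofReal ρ₀ *
            ∫⁻ t in Set.Ioc 0 δ₀, ENNReal.ofReal (min 1 (1 / (a * t ^ 2))) := by
          rw [lintegral_smul_measure, smul_eq_mul]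
      _ ≤ ENNReal.ofReal ρ₀ * ENNReal.ofReal (2 * a ^ (-(1 : ℝ) / 2)) := by
          gcongr
          exact (lintegral_mono_set Set.Ioc_subset_Ioi_self).trans
            (lintegral_Ioi_min_one_inv_sq_le ha)
      _ = ENNReal.ofReal (2 * ρ₀ * a ^ (-(1 : ℝ) / 2)) := by
          rw [← ENNReal.ofReal_mul hρ₀.le]
          ring_nf
  · calc ∫⁻ t in Set.Ioi δ₀, ENNReal.ofReal (min 1 (1 / (a * t ^ 2))) ∂P
        ≤ ∫⁻ _ in Set.Ioi δ₀, ENNReal.ofReal (δ₀ ^ (-(2 : ℝ)) * a⁻¹) ∂P := by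
          refine setLIntegral_mono' measurableSet_Ioi fun t ht => ?_
          refine ENNReal.ofReal_le_ofReal ((min_le_right _ _).trans ?_)
          have hle : δ₀ ≤ t := le_of_lt ht
          rw [Real.rpow_neg hδ₀.le, Real.rpow_two, ← mul_inv, one_div, mul_comm a]
          gcongr
      _ ≤ ENNReal.ofReal (δ₀ ^ (-(2 : ℝ)) * a⁻¹) := by
          rw [setLIntegral_const]
          exact mul_le_of_le_one_right' prob_le_one

/-- Variance of the inner Monte Carlo estimator: under the
bounded-density assumption on `δ = d/σ`, for every `N ≥ 1`,
`Var(H(Ê_N(Y)) − H(E[X|Y])) ≤ E[(H(Ê_N(Y)) − H(E[X|Y]))²] ≤ 2ρ₀·N^{-1/2} + δ₀^{-2}·N^{-1}`.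
Here `ν` is the law of the outer variable `Y`, `μ y` is the conditional law of `X` given
`Y = y` (with mean `m y`, standard deviation `σ y` and `δ y = |m y| / σ y`), and the inner
samples are modelled by the Markov kernel `κ` with `κ y` the `N`-fold product of `μ y`. -/
theorem variance_inner_mc {𝓨 : Type*} [MeasurableSpace 𝓨]
    (ν : Measure 𝓨) [IsProbabilityMeasure ν]
    (μ : 𝓨 → Measure ℝ) (hprob : ∀ y, IsProbabilityMeasure (μ y))
    (hμ2 : ∀ y, Integrable (fun x => x ^ 2) (μ y))
    (m s δ : 𝓨 → ℝ)
    (hm : ∀ y, m y = ∫ t, t ∂μ y)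
    (hs : ∀ y, s y = Real.sqrt (variance (fun t => t) (μ y)))
    (hδ : ∀ y, δ y = |m y| / s y)
    (hmmeas : Measurable m) (hδmeas : Measurable δ)
    (ρ : ℝ → ℝ) (ρ₀ δ₀ : ℝ) (hρ₀ : 0 < ρ₀) (hδ₀ : 0 < δ₀)
    (hdensity : ν.map δ = MeasureTheory.volume.withDensity fun t => ENNReal.ofReal (ρ t))
    (hρbound : ∀ t ∈ Set.Icc (0 : ℝ) δ₀, ρ t ≤ ρ₀)
    (N : ℕ) (hN : 1 ≤ N)
    (κ : Kernel 𝓨 (Fin N → ℝ)) [IsMarkovKernel κ]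
    (hκ : ∀ y, κ y = Measure.pi fun _ : Fin N => μ y) :
    variance
        (fun p : 𝓨 × (Fin N → ℝ) =>
          heaviside ((∑ n, p.2 n) / (N : ℝ)) - heaviside (m p.1)) (ν ⊗ₘ κ)
      ≤ ∫ p, (heaviside ((∑ n, p.2 n) / (N : ℝ)) - heaviside (m p.1)) ^ 2 ∂(ν ⊗ₘ κ) ∧
    ∫ p, (heaviside ((∑ n, p.2 n) / (N : ℝ)) - heaviside (m p.1)) ^ 2 ∂(ν ⊗ₘ κ)
      ≤ 2 * ρ₀ * (N : ℝ) ^ (-(1 : ℝ) / 2) + δ₀ ^ (-(2 : ℝ)) * (N : ℝ)⁻¹ := by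
  have hN0 : (0 : ℝ) < N := by exact_mod_cast hN
  have hmeas : Measurable fun p : 𝓨 × (Fin N → ℝ) =>
      heaviside ((∑ n, p.2 n) / (N : ℝ)) - heaviside (m p.1) :=
    (measurable_heaviside.comp (by fun_prop)).sub (measurable_heaviside.comp (by fun_prop))
  refine ⟨variance_le_expectation_sq hmeas.aestronglyMeasurable, ?_⟩
  have hPprob : IsProbabilityMeasure (ν.map δ) :=
    Measure.isProbabilityMeasure_map hδmeas.aemeasurable
  have hδnonneg (y : 𝓨) : 0 ≤ δ y := by
    rw [hδ, hs]
    positivity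
  have hδpos : ∀ᵐ y ∂ν, 0 < δ y := by
    have hne : ∀ᵐ t ∂(ν.map δ), t ≠ 0 := by
      rw [hdensity]
      exact (withDensity_absolutelyContinuous _ _).ae_le (Measure.ae_ne volume 0)
    filter_upwards [ae_of_ae_map hδmeas.aemeasurable hne] with y hy
    exact (hδnonneg y).lt_of_ne' hy
  have hinner (y : 𝓨) (hy : 0 < δ y) :
      ∫⁻ x, ENNReal.ofReal ((heaviside ((∑ n, x n) / (N : ℝ)) - heaviside (m y)) ^ 2) ∂κ y
        ≤ ENNReal.ofReal (min 1 (1 / (N * δ y ^ 2))) := by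
    have := hprob y
    have hm0 : m y ≠ 0 := by
      rintro h
      simp [hδ, h] at hy
    have hs0 : s y ≠ 0 := by
      rintro h
      simp [hδ, h] at hy
    have hvar : variance (fun t => t) (μ y) = s y ^ 2 := by
      rw [hs, Real.sq_sqrt (variance_nonneg _ _)]
    rw [ENNReal.ofReal_min]
    refine le_min ?_ ?_
    · calc _ ≤ ∫⁻ _, 1 ∂κ y := lintegral_mono fun x =>
            ENNReal.ofReal_le_one.2 (heaviside_sub_sq_le_one _ _)
        _ = ENNReal.ofReal 1 := by simp
    · have hset : MeasurableSet {x : Fin N → ℝ | |m y| ≤ |(∑ n, x n) / (N : ℝ) - m y|} :=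
        measurableSet_le (by fun_prop) (by fun_prop)
      calc _ ≤ ∫⁻ x, {x : Fin N → ℝ | |m y| ≤ |(∑ n, x n) / (N : ℝ) - m y|}.indicator 1 x
              ∂κ y := by
            refine lintegral_mono fun x => ?_
            refine (ENNReal.ofReal_le_ofReal (heaviside_sub_sq_le_indicator _ _)).trans_eq ?_
            simp only [Set.indicator_apply, Set.mem_ofPred_eq]
            split_ifs <;> simp
        _ = κ y {x | |m y| ≤ |(∑ n, x n) / (N : ℝ) - m y|} := lintegral_indicator_one hset
        _ ≤ ENNReal.ofReal (variance (fun t => t) (μ y) / (N * m y ^ 2)) := by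
            rw [hκ]
            exact measure_pi_abs_le_abs_mean_sub_le (μ y) (hμ2 y) (hm y) hm0 hN
        _ = ENNReal.ofReal (1 / (N * δ y ^ 2)) := by
            rw [hvar, hδ, div_pow, sq_abs]
            congr 1
            field_simp
  rw [integral_eq_lintegral_of_nonneg_ae (Filter.Eventually.of_forall fun p => sq_nonneg _)
    (hmeas.pow_const 2).aestronglyMeasurable]
  refine ENNReal.toReal_le_of_le_ofReal (by positivity) ?_
  rw [Measure.lintegral_compProd (hmeas.pow_const 2).ennreal_ofReal]
  calc _ ≤ ∫⁻ y, ENNReal.ofReal (min 1 (1 / (N * δ y ^ 2))) ∂ν :=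
        lintegral_mono_ae (hδpos.mono hinner)
    _ = ∫⁻ y in δ ⁻¹' Set.Ioi 0, ENNReal.ofReal (min 1 (1 / (N * δ y ^ 2))) ∂ν := by
        rw [Measure.restrict_eq_self_of_ae_mem (s := δ ⁻¹' Set.Ioi 0) hδpos]
    _ = ∫⁻ t in Set.Ioi 0, ENNReal.ofReal (min 1 (1 / (N * t ^ 2))) ∂(ν.map δ) := by
        rw [setLIntegral_map measurableSet_Ioi (by fun_prop) hδmeas]
    _ ≤ _ := lintegral_min_one_inv_sq_le (ν.map δ) hρ₀ hδ₀ hN0 hdensity hρbound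
end

section
/- Let 1 < r < 2 and suppose the bounded-density assumption on δ holds. Define fN_ℓ(δ) = N₀·4^ℓ·max(2^{-ℓ}, min(1, (C^{-1}·N₀^{1/2}·2^ℓ·δ)^{-r})) for constants N₀ ≥ 1 and C ≥ 1. If N_ℓ is a random number of samples, depending on Y only through δ, satisfying fN_ℓ(δ) ≤ N_ℓ < 2·fN_ℓ(δ), then E[N_ℓ] ≤ 2N₀·2^ℓ + 2C·N₀^{1/2}·ρ₀·(r/(r−1))·2^ℓ + 2C^r·N₀^{(2−r)/2}·δ₀^{-r}·2^{(2−r)ℓ}; in particular E[N_ℓ] = O(2^ℓ) as ℓ → ∞. -/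
open MeasureTheory ProbabilityTheory
open scoped ENNReal

/-- The target number of inner samples of the adaptive algorithm on level `ℓ`:
`fN_ℓ(δ) = N₀·4^ℓ·max(2^{-ℓ}, min(1, (C⁻¹·N₀^{1/2}·2^ℓ·δ)^{-r}))`, valued in `ℝ≥0∞`
so that the convention `0^{-r} = ∞` is respected when `δ = 0`. -/
noncomputable def adaptiveTarget (N₀ : ℕ) (C r : ℝ) (ℓ : ℕ) (t : ℝ) : ℝ≥0∞ :=
  (N₀ : ℝ≥0∞) * 4 ^ ℓ *
    max ((2 : ℝ≥0∞) ^ ℓ)⁻¹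
      (min 1 ((ENNReal.ofReal (C⁻¹ * (N₀ : ℝ) ^ ((1 : ℝ) / 2) * 2 ^ ℓ * t)) ^ (-r)))

/-- The capped power `min 1 (a t)^{-r}` has Lebesgue integral at most `a⁻¹ r / (r - 1)`
over the half-line. -/
theorem lintegral_Ici_min_one_rpow_le {a r : ℝ} (ha : 0 < a) (hr : 1 < r) :
    ∫⁻ t in Set.Ici (0 : ℝ), min 1 (ENNReal.ofReal (a * t) ^ (-r))
      ≤ ENNReal.ofReal (a⁻¹ * (r / (r - 1))) := by
  have ha' : 0 < a⁻¹ := inv_pos.2 ha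
  have hint : IntegrableOn (fun t : ℝ => a ^ (-r) * t ^ (-r)) (Set.Ioi a⁻¹) :=
    (integrableOn_Ioi_rpow_of_lt (by linarith) ha').const_mul _
  have hnear : ∫⁻ t in Set.Icc (0 : ℝ) a⁻¹, min 1 (ENNReal.ofReal (a * t) ^ (-r))
      ≤ ENNReal.ofReal a⁻¹ := by
    calc ∫⁻ t in Set.Icc (0 : ℝ) a⁻¹, min 1 (ENNReal.ofReal (a * t) ^ (-r))
        ≤ ∫⁻ _ in Set.Icc (0 : ℝ) a⁻¹, 1 := lintegral_mono fun t => min_le_left _ _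
      _ = ENNReal.ofReal a⁻¹ := by simp
  have hfar : ∫⁻ t in Set.Ioi a⁻¹, min 1 (ENNReal.ofReal (a * t) ^ (-r))
      ≤ ENNReal.ofReal (a⁻¹ * (1 / (r - 1))) := by
    calc ∫⁻ t in Set.Ioi a⁻¹, min 1 (ENNReal.ofReal (a * t) ^ (-r))
        ≤ ∫⁻ t in Set.Ioi a⁻¹, ENNReal.ofReal (a ^ (-r) * t ^ (-r)) := by
          refine setLIntegral_mono' measurableSet_Ioi fun t ht => ?_
          have ht' : 0 < t := ha'.trans ht
          refine (min_le_right _ _).trans_eq ?_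
          rw [ENNReal.ofReal_rpow_of_pos (mul_pos ha ht'), Real.mul_rpow ha.le ht'.le]
      _ = ENNReal.ofReal (∫ t in Set.Ioi a⁻¹, a ^ (-r) * t ^ (-r)) := by
          refine (ofReal_integral_eq_lintegral_ofReal hint ?_).symm
          filter_upwards [ae_restrict_mem measurableSet_Ioi] with t ht
          have ht' : 0 < t := ha'.trans ht
          simp only [Pi.zero_apply]
          positivity
      _ = ENNReal.ofReal (a⁻¹ * (1 / (r - 1))) := by
          congr 1
          rw [integral_const_mul, integral_Ioi_rpow_of_lt (by linarith) ha',
            Real.inv_rpow ha.le, ← Real.rpow_neg ha.le, mul_div_assoc', mul_neg,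
            ← Real.rpow_add ha, show -r + -(-r + 1) = -1 by ring, Real.rpow_neg_one,
            mul_one_div, show -r + 1 = -(r - 1) by ring, neg_div_neg_eq]
  have hr' : r - 1 ≠ 0 := by linarith
  calc ∫⁻ t in Set.Ici (0 : ℝ), min 1 (ENNReal.ofReal (a * t) ^ (-r))
      ≤ _ + _ := by
        rw [← Set.Icc_union_Ioi_eq_Ici ha'.le]
        exact lintegral_union_le _ _ _
    _ ≤ ENNReal.ofReal a⁻¹ + ENNReal.ofReal (a⁻¹ * (1 / (r - 1))) := add_le_add hnear hfar
    _ = ENNReal.ofReal (a⁻¹ * (r / (r - 1))) := by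
        rw [← ENNReal.ofReal_add ha'.le (mul_nonneg ha'.le (by
          exact one_div_nonneg.2 (by linarith)))]
        congr 1
        field_simp
        ring

/-- Expectation of the capped power `min 1 (a t)^{-r}` under a probability measure on the
nonnegative reals whose density is at most `ρ₀` on `[0, δ₀]`. -/
theorem lintegral_min_one_rpow_le_of_restrict_le {P : Measure ℝ} [IsProbabilityMeasure P]
    {a r ρ₀ δ₀ : ℝ} (ha : 0 < a) (hr : 1 < r) (hρ₀ : 0 ≤ ρ₀) (hδ₀ : 0 < δ₀)
    (hneg : P (Set.Iio 0) = 0)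
    (hP : P.restrict (Set.Icc 0 δ₀) ≤
      ENNReal.ofReal ρ₀ • (volume : Measure ℝ).restrict (Set.Icc 0 δ₀)) :
    ∫⁻ t, min 1 (ENNReal.ofReal (a * t) ^ (-r)) ∂P
      ≤ ENNReal.ofReal (ρ₀ * (a⁻¹ * (r / (r - 1))) + (a * δ₀) ^ (-r)) := by
  have hnear : ∫⁻ t in Set.Icc 0 δ₀, min 1 (ENNReal.ofReal (a * t) ^ (-r)) ∂P
      ≤ ENNReal.ofReal (ρ₀ * (a⁻¹ * (r / (r - 1)))) := by
    calc ∫⁻ t in Set.Icc 0 δ₀, min 1 (ENNReal.ofReal (a * t) ^ (-r)) ∂P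
        ≤ ENNReal.ofReal ρ₀ *
            ∫⁻ t in Set.Icc 0 δ₀, min 1 (ENNReal.ofReal (a * t) ^ (-r)) := by
          refine (lintegral_mono' hP le_rfl).trans_eq ?_
          rw [lintegral_smul_measure, smul_eq_mul]
      _ ≤ ENNReal.ofReal ρ₀ * ENNReal.ofReal (a⁻¹ * (r / (r - 1))) := by
          gcongr
          exact (lintegral_mono_set Set.Icc_subset_Ici_self).trans
            (lintegral_Ici_min_one_rpow_le ha hr)
      _ = _ := (ENNReal.ofReal_mul hρ₀).symm
  have hfar : ∫⁻ t in Set.Ioi δ₀, min 1 (ENNReal.ofReal (a * t) ^ (-r)) ∂P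
      ≤ ENNReal.ofReal ((a * δ₀) ^ (-r)) := by
    calc ∫⁻ t in Set.Ioi δ₀, min 1 (ENNReal.ofReal (a * t) ^ (-r)) ∂P
        ≤ ∫⁻ _ in Set.Ioi δ₀, ENNReal.ofReal ((a * δ₀) ^ (-r)) ∂P := by
          refine setLIntegral_mono' measurableSet_Ioi fun t ht => ?_
          have ht' : δ₀ < t := ht
          refine (min_le_right _ _).trans ?_
          rw [ENNReal.ofReal_rpow_of_pos (mul_pos ha (hδ₀.trans ht'))]
          exact ENNReal.ofReal_le_ofReal (Real.rpow_le_rpow_of_nonpos (mul_pos ha hδ₀)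
            (by gcongr) (by linarith))
      _ = ENNReal.ofReal ((a * δ₀) ^ (-r)) * P (Set.Ioi δ₀) := setLIntegral_const _ _
      _ ≤ ENNReal.ofReal ((a * δ₀) ^ (-r)) := mul_le_of_le_one_right' prob_le_one
  have hae : ∀ᵐ t ∂P, t ∈ Set.Ici (0 : ℝ) := by
    rw [ae_iff]
    simpa [Set.Iio] using hneg
  calc ∫⁻ t, min 1 (ENNReal.ofReal (a * t) ^ (-r)) ∂P
      = ∫⁻ t in Set.Ici 0, min 1 (ENNReal.ofReal (a * t) ^ (-r)) ∂P := by
        rw [Measure.restrict_eq_self_of_ae_mem hae]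
    _ ≤ _ + _ := by
        rw [← Set.Icc_union_Ioi_eq_Ici hδ₀.le]
        exact lintegral_union_le _ _ _
    _ ≤ ENNReal.ofReal (ρ₀ * (a⁻¹ * (r / (r - 1)))) + ENNReal.ofReal ((a * δ₀) ^ (-r)) :=
        add_le_add hnear hfar
    _ = _ := by
        have : 0 < r - 1 := by linarith
        rw [ENNReal.ofReal_add (by positivity) (by positivity)]

/-- A measure with a (not necessarily measurable) density bounded by `c` on a measurable set `s`
is dominated on `s` by `c` times the reference measure. -/
theorem restrict_withDensity_le_smul {α : Type*} [MeasurableSpace α] {κ : Measure α}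
    {f : α → ℝ≥0∞} {c : ℝ≥0∞} {s : Set α} (hs : MeasurableSet s) (hf : ∀ x ∈ s, f x ≤ c) :
    (κ.withDensity f).restrict s ≤ c • κ.restrict s := by
  refine Measure.le_iff.2 fun u hu => ?_
  rw [Measure.restrict_apply hu, withDensity_apply _ (hu.inter hs), Measure.smul_apply,
    Measure.restrict_apply hu, smul_eq_mul, ← setLIntegral_const]
  exact setLIntegral_mono' (hu.inter hs) fun x hx => hf x hx.2

/-- Expected work of perfect adaptive sampling: under the
bounded-density assumption on `δ = d/σ`, if the random number of samples `N_ℓ`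
(a function of `Y` through `δ`) satisfies `fN_ℓ(δ) ≤ N_ℓ < 2·fN_ℓ(δ)` with `1 < r < 2`,
`N₀ ≥ 1` and `C ≥ 1`, then
`E[N_ℓ] ≤ 2N₀·2^ℓ + 2C·N₀^{1/2}·ρ₀·(r/(r−1))·2^ℓ + 2C^r·N₀^{(2−r)/2}·δ₀^{-r}·2^{(2−r)ℓ}`,
which is `O(2^ℓ)`. -/
theorem expected_work_perfect_adaptive {𝓨 : Type*} [MeasurableSpace 𝓨]
    (ν : Measure 𝓨) [IsProbabilityMeasure ν]
    (μ : 𝓨 → Measure ℝ) (hprob : ∀ y, IsProbabilityMeasure (μ y))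
    (hμ2 : ∀ y, Integrable (fun x => x ^ 2) (μ y))
    (m s δ : 𝓨 → ℝ)
    (hm : ∀ y, m y = ∫ t, t ∂μ y)
    (hs : ∀ y, s y = Real.sqrt (variance (fun t => t) (μ y)))
    (hδ : ∀ y, δ y = |m y| / s y)
    (hδmeas : Measurable δ)
    (ρ : ℝ → ℝ) (ρ₀ δ₀ : ℝ) (hρ₀ : 0 < ρ₀) (hδ₀ : 0 < δ₀)
    (hdensity : ν.map δ = MeasureTheory.volume.withDensity fun t => ENNReal.ofReal (ρ t))
    (hρbound : ∀ t ∈ Set.Icc (0 : ℝ) δ₀, ρ t ≤ ρ₀)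
    (r : ℝ) (hr1 : 1 < r) (hr2 : r < 2)
    (N₀ : ℕ) (hN₀ : 1 ≤ N₀) (C : ℝ) (hC : 1 ≤ C)
    (ℓ : ℕ) (Nl : ℝ → ℕ)
    (hNl : ∀ t : ℝ, 0 ≤ t →
      adaptiveTarget N₀ C r ℓ t ≤ (Nl t : ℝ≥0∞) ∧
      (Nl t : ℝ≥0∞) < 2 * adaptiveTarget N₀ C r ℓ t) :
    ∫⁻ y, (Nl (δ y) : ℝ≥0∞) ∂ν
      ≤ ENNReal.ofReal
          (2 * N₀ * 2 ^ ℓ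
            + 2 * C * (N₀ : ℝ) ^ ((1 : ℝ) / 2) * ρ₀ * (r / (r - 1)) * 2 ^ ℓ
            + 2 * C ^ r * (N₀ : ℝ) ^ ((2 - r) / 2) * δ₀ ^ (-r) * 2 ^ ((2 - r) * ℓ)) := by
  have hN : (0 : ℝ) < N₀ := by exact_mod_cast hN₀
  have hC0 : 0 < C := by linarith
  have hr0 : 0 < r - 1 := by linarith
  set a : ℝ := C⁻¹ * (N₀ : ℝ) ^ ((1 : ℝ) / 2) * 2 ^ ℓ with ha_def
  have ha : 0 < a := by positivity
  have hδ_nonneg : ∀ y, 0 ≤ δ y := fun y => by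
    rw [hδ, hs]
    positivity
  have : IsProbabilityMeasure (ν.map δ) := Measure.isProbabilityMeasure_map hδmeas.aemeasurable
  have hneg : ν.map δ (Set.Iio 0) = 0 := by
    rw [Measure.map_apply hδmeas measurableSet_Iio]
    exact measure_mono_null (fun y hy => (hδ_nonneg y).not_gt hy) measure_empty
  have hrestrict : (ν.map δ).restrict (Set.Icc 0 δ₀) ≤
      ENNReal.ofReal ρ₀ • (volume : Measure ℝ).restrict (Set.Icc 0 δ₀) := by
    rw [hdensity]
    exact restrict_withDensity_le_smul measurableSet_Icc fun t ht =>
      ENNReal.ofReal_le_ofReal (hρbound t ht)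
  have hexp := lintegral_min_one_rpow_le_of_restrict_le ha hr1 hρ₀.le hδ₀ hneg hrestrict
  have hmeas : Measurable fun t : ℝ => min 1 (ENNReal.ofReal (a * t) ^ (-r)) := by fun_prop
  rw [lintegral_map hmeas hδmeas] at hexp
  have htwo : ((2 : ℝ≥0∞) ^ ℓ)⁻¹ = ENNReal.ofReal ((2 ^ ℓ)⁻¹) := by
    rw [ENNReal.ofReal_inv_of_pos (by positivity), ENNReal.ofReal_pow zero_le_two,
      ENNReal.ofReal_ofNat]
  have hfactor : 2 * ((N₀ : ℝ≥0∞) * 4 ^ ℓ) = ENNReal.ofReal (2 * (N₀ * 4 ^ ℓ)) := by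
    rw [ENNReal.ofReal_mul zero_le_two, ENNReal.ofReal_mul hN.le,
      ENNReal.ofReal_pow zero_le_four, ENNReal.ofReal_ofNat, ENNReal.ofReal_ofNat,
      ENNReal.ofReal_natCast]
  calc ∫⁻ y, (Nl (δ y) : ℝ≥0∞) ∂ν
      ≤ ∫⁻ y, 2 * ((N₀ : ℝ≥0∞) * 4 ^ ℓ) *
          (((2 : ℝ≥0∞) ^ ℓ)⁻¹ + min 1 (ENNReal.ofReal (a * δ y) ^ (-r))) ∂ν := by
        refine lintegral_mono fun y => ((hNl (δ y) (hδ_nonneg y)).2.le).trans ?_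
        rw [adaptiveTarget, ← mul_assoc]
        gcongr
        exact max_le_add_of_nonneg zero_le zero_le
    _ = 2 * ((N₀ : ℝ≥0∞) * 4 ^ ℓ) *
          (((2 : ℝ≥0∞) ^ ℓ)⁻¹ + ∫⁻ y, min 1 (ENNReal.ofReal (a * δ y) ^ (-r)) ∂ν) := by
        rw [lintegral_const_mul _ (by fun_prop),
          lintegral_add_left measurable_const, lintegral_const, measure_univ, mul_one]
    _ ≤ 2 * ((N₀ : ℝ≥0∞) * 4 ^ ℓ) * (((2 : ℝ≥0∞) ^ ℓ)⁻¹ +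
          ENNReal.ofReal (ρ₀ * (a⁻¹ * (r / (r - 1))) + (a * δ₀) ^ (-r))) := by
        gcongr
    _ = ENNReal.ofReal (2 * (N₀ * 4 ^ ℓ) *
          ((2 ^ ℓ)⁻¹ + (ρ₀ * (a⁻¹ * (r / (r - 1))) + (a * δ₀) ^ (-r)))) := by
        rw [htwo, hfactor, ← ENNReal.ofReal_add (by positivity) (by positivity),
          ← ENNReal.ofReal_mul (by positivity)]
    _ = _ := by
        congr 1
        have hfour : (4 : ℝ) ^ ℓ = 2 ^ ℓ * 2 ^ ℓ := by rw [← mul_pow]; norm_num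
        have hsqrt : (N₀ : ℝ) = (N₀ : ℝ) ^ ((1 : ℝ) / 2) * (N₀ : ℝ) ^ ((1 : ℝ) / 2) := by
          rw [← Real.rpow_add hN]
          norm_num
        have hsecond : N₀ * 4 ^ ℓ * a⁻¹ = C * (N₀ : ℝ) ^ ((1 : ℝ) / 2) * 2 ^ ℓ := by
          rw [hfour, ha_def]
          nth_rewrite 1 [hsqrt]
          field_simp
        have hNpow : (N₀ : ℝ) * ((N₀ : ℝ) ^ ((1 : ℝ) / 2)) ^ (-r) = (N₀ : ℝ) ^ ((2 - r) / 2) := by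
          rw [← Real.rpow_mul hN.le, ← Real.rpow_one_add' hN.le (by linarith)]
          congr 1
          ring
        have htwopow : (4 : ℝ) ^ ℓ * ((2 : ℝ) ^ ℓ) ^ (-r) = 2 ^ ((2 - r) * ℓ) := by
          rw [hfour, ← Real.rpow_natCast, ← Real.rpow_mul zero_le_two,
            ← Real.rpow_add two_pos, ← Real.rpow_add two_pos]
          congr 1
          ring
        have hthird : N₀ * 4 ^ ℓ * (a * δ₀) ^ (-r)
            = C ^ r * (N₀ : ℝ) ^ ((2 - r) / 2) * δ₀ ^ (-r) * 2 ^ ((2 - r) * ℓ) := by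
          rw [ha_def, Real.mul_rpow (by positivity) hδ₀.le,
            Real.mul_rpow (by positivity) (by positivity),
            Real.mul_rpow (by positivity) (by positivity), Real.inv_rpow hC0.le,
            Real.rpow_neg hC0.le, inv_inv, ← hNpow, ← htwopow]
          ring
        have hfirst : N₀ * 4 ^ ℓ * ((2 : ℝ) ^ ℓ)⁻¹ = N₀ * 2 ^ ℓ := by
          rw [hfour]
          field_simp
        linear_combination 2 * hfirst + 2 * ρ₀ * (r / (r - 1)) * hsecond + 2 * hthird
end

section
/- Suppose the bounded-density assumption on δ and the bounded-moment assumption with exponent q > 2 hold, and additionally E[σ²] < ∞ and there exists σ₀ such that σ ≤ σ₀ whenever δ < δ₀. Let N_ℓ = N₀·2^ℓ and, given Y, let Ê₁ and Ê₂ be two conditionally independent Monte Carlo averages, each of N_ℓ/2 samples of X given Y, and define the antithetic difference G_ℓ = max(0, (Ê₁+Ê₂)/2) − (1/2)·max(0, Ê₁) − (1/2)·max(0, Ê₂). Then E[|G_ℓ|] = O(N_ℓ^{-1}) and E[G_ℓ²] = O(N_ℓ^{-min(3,q)/2}) as ℓ → ∞. -/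
open MeasureTheory ProbabilityTheory
open scoped ENNReal

/-- Second and fourth moments of a sum of independent centred bounded random variables. -/
lemma moments_sum_of_iIndepFun {Ω ι : Type*} [MeasurableSpace Ω] {P : Measure Ω}
    [IsProbabilityMeasure P] {X : ι → Ω → ℝ} (hX : ∀ i, Measurable (X i))
    (hindep : iIndepFun X P) {C : ℝ} (hC : ∀ i ω, |X i ω| ≤ C)
    (h1 : ∀ i, ∫ ω, X i ω ∂P = 0) {v w : ℝ} (hv : 0 ≤ v)
    (h2 : ∀ i, ∫ ω, X i ω ^ 2 ∂P ≤ v) (h4 : ∀ i, ∫ ω, X i ω ^ 4 ∂P ≤ w) (s : Finset ι) :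
    ∫ ω, (∑ i ∈ s, X i ω) ∂P = 0 ∧ ∫ ω, (∑ i ∈ s, X i ω) ^ 2 ∂P ≤ s.card * v ∧
      ∫ ω, (∑ i ∈ s, X i ω) ^ 4 ∂P ≤ s.card * w + 3 * (s.card : ℝ) ^ 2 * v ^ 2 := by
  classical
  induction s using Finset.induction_on with
  | empty => simp
  | insert a s ha ih =>
    obtain ⟨ih1, ih2, ih4⟩ := ih
    set S : Ω → ℝ := fun ω => ∑ i ∈ s, X i ω with hS
    have hSm : Measurable S := Finset.measurable_fun_sum s fun i _ => hX i
    have hSb : ∀ ω, |S ω| ≤ s.card * C := fun ω => by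
      calc |S ω| ≤ ∑ i ∈ s, |X i ω| := Finset.abs_sum_le_sum_abs _ _
        _ ≤ ∑ i ∈ s, C := Finset.sum_le_sum fun i _ => hC i ω
        _ = s.card * C := by simp
    have hI : ∀ j k : ℕ, Integrable (fun ω => S ω ^ j * X a ω ^ k) P := fun j k => by
      refine Integrable.of_bound (C := (s.card * C) ^ j * C ^ k)
        (by fun_prop) (Filter.Eventually.of_forall fun ω => ?_)
      rw [Real.norm_eq_abs, abs_mul, abs_pow, abs_pow]
      have := hC a ω
      have := hSb ω
      have h0 : 0 ≤ C := (abs_nonneg _).trans (hC a ω)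
      gcongr
    have hind : IndepFun S (X a) P := by
      have := hindep.indepFun_finsetSum_of_notMem hX ha
      convert this using 1
      ext ω; simp [hS]
    have hmul : ∀ j k : ℕ, ∫ ω, S ω ^ j * X a ω ^ k ∂P
        = (∫ ω, S ω ^ j ∂P) * ∫ ω, X a ω ^ k ∂P := fun j k => by
      have := hind.comp (φ := fun x : ℝ => x ^ j) (ψ := fun x : ℝ => x ^ k)
        (by fun_prop) (by fun_prop)
      exact this.integral_fun_mul_eq_mul_integral (by fun_prop) (by fun_prop)
    have hSI : ∀ j : ℕ, Integrable (fun ω => S ω ^ j) P := fun j => by simpa using hI j 0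
    have hXI : ∀ j : ℕ, Integrable (fun ω => X a ω ^ j) P := fun j => by simpa using hI 0 j
    have hSI1 : Integrable S P := by simpa using hSI 1
    have hXI1 : Integrable (X a) P := by simpa using hXI 1
    have hS2 : 0 ≤ ∫ ω, S ω ^ 2 ∂P := integral_nonneg fun ω => sq_nonneg _
    have hX2 : 0 ≤ ∫ ω, X a ω ^ 2 ∂P := integral_nonneg fun ω => sq_nonneg _
    have hsum : ∀ ω, ∑ i ∈ insert a s, X i ω = S ω + X a ω := fun ω => by
      rw [Finset.sum_insert ha, add_comm]
    simp only [hsum, Finset.card_insert_of_notMem ha]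
    push_cast
    refine ⟨?_, ?_, ?_⟩
    · rw [integral_add hSI1 hXI1, ih1, h1, add_zero]
    · have e : ∀ ω, (S ω + X a ω) ^ 2 = S ω ^ 2 * X a ω ^ 0 + 2 * (S ω ^ 1 * X a ω ^ 1)
          + S ω ^ 0 * X a ω ^ 2 := fun ω => by ring
      simp only [e]
      rw [integral_add ((hI 2 0).fun_add ((hI 1 1).const_mul 2)) (hI 0 2),
        integral_add (hI 2 0) ((hI 1 1).const_mul 2), integral_const_mul, hmul, hmul, hmul]
      simp only [pow_zero, pow_one, h1, integral_const, probReal_univ, smul_eq_mul]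
      nlinarith [h2 a]
    · have e : ∀ ω, (S ω + X a ω) ^ 4 = S ω ^ 4 * X a ω ^ 0 + 4 * (S ω ^ 3 * X a ω ^ 1)
          + 6 * (S ω ^ 2 * X a ω ^ 2) + 4 * (S ω ^ 1 * X a ω ^ 3)
          + S ω ^ 0 * X a ω ^ 4 := fun ω => by ring
      simp only [e]
      have i1 := (hI 4 0).fun_add ((hI 3 1).const_mul 4)
      have i2 := i1.fun_add ((hI 2 2).const_mul 6)
      have i3 := i2.fun_add ((hI 1 3).const_mul 4)
      rw [integral_add i3 (hI 0 4), integral_add i2 ((hI 1 3).const_mul 4),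
        integral_add i1 ((hI 2 2).const_mul 6), integral_add (hI 4 0) ((hI 3 1).const_mul 4)]
      simp only [integral_const_mul, hmul]
      simp only [pow_zero, pow_one, h1, ih1, integral_const, probReal_univ, smul_eq_mul]
      have := mul_le_mul ih2 (h2 a) hX2 (by positivity)
      nlinarith [h4 a, sq_nonneg v]

lemma integral_sum_sq_pi {μ : Measure ℝ} [IsProbabilityMeasure μ] {f : ℝ → ℝ}
    (hf : MemLp f 2 μ) (h0 : ∫ t, f t ∂μ = 0) (M : ℕ) :
    ∫ x : Fin M → ℝ, (∑ i, f (x i)) ^ 2 ∂(Measure.pi fun _ => μ) = M * ∫ t, f t ^ 2 ∂μ := by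
  have hI : ∀ i : Fin M, Integrable (fun x : Fin M → ℝ => f (x i)) (Measure.pi fun _ => μ) :=
    fun i => (measurePreserving_eval (fun _ : Fin M => μ) i).integrable_comp_of_integrable
      (hf.integrable one_le_two)
  have h := variance_sum_pi (μ := fun _ : Fin M => μ) (X := fun _ => f) fun _ => hf
  rw [variance_of_integral_eq_zero, variance_of_integral_eq_zero hf.aemeasurable h0] at h
  · simpa using h
  · exact Finset.aemeasurable_sum _ fun i _ => (hI i).aemeasurable
  · simp only [Finset.sum_apply]
    rw [integral_finsetSum _ fun i _ => hI i]
    refine Finset.sum_eq_zero fun i _ => ?_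
    rw [integral_comp_eval (μ := fun _ : Fin M => μ) hf.aestronglyMeasurable, h0]

lemma memLp_sum_pi {μ : Measure ℝ} [IsProbabilityMeasure μ] {f : ℝ → ℝ}
    (hf : MemLp f 2 μ) (M : ℕ) :
    MemLp (fun x : Fin M → ℝ => ∑ i, f (x i)) 2 (Measure.pi fun _ => μ) :=
  memLp_finsetSum _ fun i _ => hf.comp_measurePreserving
    (measurePreserving_eval (fun _ : Fin M => μ) i)

lemma integral_sub_integral_sq_le {μ : Measure ℝ} [IsProbabilityMeasure μ] {g : ℝ → ℝ}
    (hg : AEStronglyMeasurable g μ) :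
    ∫ t, (g t - ∫ x, g x ∂μ) ^ 2 ∂μ ≤ ∫ t, g t ^ 2 ∂μ := by
  rw [← variance_eq_integral hg.aemeasurable]
  exact variance_le_expectation_sq hg

lemma add_sq_le_of_le_abs_add {u A B : ℝ} (hu : 0 < u) (h : u ≤ |A + B|) :
    (A + B) ^ 2 ≤ 16 / u ^ 2 * A ^ 4 + 4 * B ^ 2 := by
  have hu2 : u ^ 2 ≤ (A + B) ^ 2 := by
    rw [← sq_abs (A + B)]; gcongr
  have hAB : (A + B) ^ 2 ≤ 2 * (A ^ 2 + B ^ 2) := add_sq_le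
  rcases le_total (A ^ 2) (B ^ 2) with hle | hle
  · have : 0 ≤ 16 / u ^ 2 * A ^ 4 := by positivity
    linarith
  · have h4 : 4 * A ^ 2 ≤ 16 / u ^ 2 * A ^ 4 := by
      rw [div_mul_eq_mul_div, le_div_iff₀ (by positivity)]
      have := mul_le_mul_of_nonneg_left (by linarith : u ^ 2 ≤ 4 * A ^ 2)
        (by positivity : 0 ≤ 4 * A ^ 2)
      linarith
    have := sq_nonneg B
    linarith

/-- Truncated second moment of a sum of i.i.d. centred variables with a finite `q`-th moment. -/
lemma integral_sum_sq_indicator_le {μ : Measure ℝ} [IsProbabilityMeasure μ] {f : ℝ → ℝ}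
    (hfm : Measurable f) (hf : MemLp f 2 μ) (h0 : ∫ t, f t ∂μ = 0) {q : ℝ} (hq2 : 2 ≤ q)
    (hq4 : q ≤ 4) (hK : Integrable (fun t => |f t| ^ q) μ) {u : ℝ} (hu : 0 < u) (M : ℕ) :
    ∫ x : Fin M → ℝ, {x | u ≤ |∑ i, f (x i)|}.indicator (fun x => (∑ i, f (x i)) ^ 2) x
        ∂(Measure.pi fun _ => μ)
      ≤ 260 * M * u ^ (2 - q) * (∫ t, |f t| ^ q ∂μ)
        + 48 * M ^ 2 * (∫ t, f t ^ 2 ∂μ) ^ 2 / u ^ 2 := by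
  classical
  set K := ∫ t, |f t| ^ q ∂μ with hKdef
  set v := ∫ t, f t ^ 2 ∂μ with hv
  set a : ℝ → ℝ := fun t => if |f t| ≤ u then f t else 0 with ha
  set b : ℝ → ℝ := fun t => f t - a t with hb
  have ham : Measurable a :=
    Measurable.ite (measurableSet_le (by fun_prop) measurable_const) hfm measurable_const
  have hau : ∀ t, |a t| ≤ u := fun t => by
    by_cases h : |f t| ≤ u <;> simp [ha, h, hu.le]
  have haI : MemLp a 2 μ := MemLp.of_bound ham.aestronglyMeasurable u
    (Filter.Eventually.of_forall hau)
  have hbI : MemLp b 2 μ := hf.sub haI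
  set c := ∫ t, a t ∂μ with hc
  have hbc : ∫ t, b t ∂μ = -c := by
    rw [hb, integral_sub (hf.integrable one_le_two) (haI.integrable one_le_two), h0, zero_sub]
  have hcu : |c| ≤ u := by
    simpa using norm_integral_le_of_norm_le_const (μ := μ) (f := a) (C := u)
      (Filter.Eventually.of_forall hau)
  have hKnn : 0 ≤ K := integral_nonneg fun t => by positivity
  have ha4 : ∀ t, a t ^ 4 ≤ u ^ (4 - q) * |f t| ^ q := fun t => by
    by_cases h : |f t| ≤ u
    · have e : a t ^ 4 = |f t| ^ (4 - q) * |f t| ^ q := by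
        rw [← Real.rpow_add_of_nonneg (abs_nonneg _) (by linarith) (by linarith)]
        simp only [ha, h, if_true]
        rw [← Even.pow_abs (by decide : Even 4)]
        norm_num
      rw [e]
      have := Real.rpow_le_rpow (abs_nonneg _) h (by linarith : 0 ≤ 4 - q)
      gcongr
    · simp only [ha, h, if_false, ne_eq, OfNat.ofNat_ne_zero, not_false_eq_true, zero_pow]
      positivity
  have hsplit : ∀ t, u < |f t| → |f t| ^ (2 - q) ≤ u ^ (2 - q) := fun t h =>
    Real.rpow_le_rpow_of_nonpos hu h.le (by linarith)
  have hb2 : ∀ t, b t ^ 2 ≤ u ^ (2 - q) * |f t| ^ q := fun t => by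
    by_cases h : |f t| ≤ u
    · simp only [hb, ha, h, if_true, sub_self, ne_eq, OfNat.ofNat_ne_zero, not_false_eq_true,
        zero_pow]
      positivity
    · push Not at h
      have hpos : 0 < |f t| := hu.trans h
      have e : b t ^ 2 = |f t| ^ (2 - q) * |f t| ^ q := by
        rw [← Real.rpow_add hpos]
        simp [hb, ha, h.not_ge]
      rw [e]
      have := hsplit t h
      gcongr
  have ha2 : ∀ t, a t ^ 2 ≤ f t ^ 2 := fun t => by
    by_cases h : |f t| ≤ u <;> simp [ha, h, sq_nonneg]
  have ha4I : ∫ t, a t ^ 4 ∂μ ≤ u ^ (4 - q) * K := by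
    rw [hKdef, ← integral_const_mul]
    exact integral_mono_of_nonneg (Filter.Eventually.of_forall fun t => by positivity)
      (hK.const_mul _) (Filter.Eventually.of_forall ha4)
  have hb2I : ∫ t, b t ^ 2 ∂μ ≤ u ^ (2 - q) * K := by
    rw [hKdef, ← integral_const_mul]
    exact integral_mono_of_nonneg (Filter.Eventually.of_forall fun t => by positivity)
      (hK.const_mul _) (Filter.Eventually.of_forall hb2)
  have ha2I : ∫ t, a t ^ 2 ∂μ ≤ v :=
    integral_mono_of_nonneg (Filter.Eventually.of_forall fun t => by positivity)
      hf.integrable_sq (Filter.Eventually.of_forall ha2)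
  have hc2 : c ^ 2 ≤ ∫ t, a t ^ 2 ∂μ := by
    have h := variance_nonneg a μ
    rw [variance_eq_sub haI] at h
    simpa using h
  have ha4int : Integrable (fun t => a t ^ 4) μ :=
    Integrable.of_bound (C := u ^ 4) (by fun_prop) (Filter.Eventually.of_forall fun t => by
      rw [Real.norm_eq_abs, abs_pow]; gcongr; exact hau t)
  have hc4 : c ^ 4 ≤ ∫ t, a t ^ 4 ∂μ := by
    have hL : MemLp (fun t => a t ^ 2) 2 μ := MemLp.of_bound (by fun_prop) (u ^ 2)
      (Filter.Eventually.of_forall fun t => by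
        rw [Real.norm_eq_abs, abs_pow]; gcongr; exact hau t)
    have h := variance_nonneg (fun t => a t ^ 2) μ
    rw [variance_eq_sub hL] at h
    simp only [Pi.pow_apply, ← pow_mul] at h
    norm_num at h
    have : c ^ 4 ≤ (∫ t, a t ^ 2 ∂μ) ^ 2 := by nlinarith [sq_nonneg c]
    linarith
  have hA2 : ∫ t, (a t - c) ^ 2 ∂μ ≤ v :=
    (integral_sub_integral_sq_le ham.aestronglyMeasurable).trans ha2I
  have hA4 : ∫ t, (a t - c) ^ 4 ∂μ ≤ 16 * (u ^ (4 - q) * K) := by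
    have : ∫ t, (a t - c) ^ 4 ∂μ ≤ ∫ t, (8 * a t ^ 4 + 8 * c ^ 4) ∂μ := by
      refine integral_mono_of_nonneg (Filter.Eventually.of_forall fun t => by positivity)
        ((ha4int.const_mul 8).fun_add (integrable_const _)) (Filter.Eventually.of_forall fun t => ?_)
      have h1 : (a t - c) ^ 2 ≤ 2 * a t ^ 2 + 2 * c ^ 2 := by nlinarith [sq_nonneg (a t + c)]
      have h2 : ((a t - c) ^ 2) ^ 2 ≤ (2 * a t ^ 2 + 2 * c ^ 2) ^ 2 := by gcongr
      simp only
      nlinarith [sq_nonneg (a t ^ 2 - c ^ 2)]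
    rw [integral_add (ha4int.const_mul 8) (integrable_const _), integral_const_mul] at this
    simp only [integral_const, probReal_univ, one_smul] at this
    linarith
  have hB2 : ∫ t, (b t + c) ^ 2 ∂μ ≤ u ^ (2 - q) * K := by
    have h := integral_sub_integral_sq_le hbI.aestronglyMeasurable
    rw [hbc] at h
    simp only [sub_neg_eq_add] at h
    exact h.trans hb2I
  have hAb : ∀ t, |a t - c| ≤ 2 * u := fun t => by
    have := abs_sub (a t) c
    linarith [hau t]
  have hA0 : ∫ t, (a t - c) ∂μ = 0 := by
    rw [integral_sub (haI.integrable one_le_two) (integrable_const _)]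
    simp [hc]
  have hB0 : ∫ t, (b t + c) ∂μ = 0 := by
    rw [integral_add (hbI.integrable one_le_two) (integrable_const _), hbc]
    simp
  have hBL : MemLp (fun t => b t + c) 2 μ := hbI.add (memLp_const c)
  have hSA : ∫ x : Fin M → ℝ, (∑ i, (a (x i) - c)) ^ 4 ∂(Measure.pi fun _ => μ)
      ≤ M * (16 * (u ^ (4 - q) * K)) + 3 * (M : ℝ) ^ 2 * v ^ 2 := by
    have hev : ∀ (g : ℝ → ℝ), Measurable g → ∀ i : Fin M,
        ∫ x : Fin M → ℝ, g (x i) ∂(Measure.pi fun _ => μ) = ∫ t, g t ∂μ := fun g hg i =>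
      integral_comp_eval (μ := fun _ : Fin M => μ) hg.aestronglyMeasurable
    have h := (moments_sum_of_iIndepFun (P := Measure.pi fun _ : Fin M => μ)
      (X := fun i x => a (x i) - c) (C := 2 * u) (v := v) (w := 16 * (u ^ (4 - q) * K))
      (fun i => by fun_prop)
      (iIndepFun_pi (X := fun _ t => a t - c) fun i => by fun_prop)
      (fun i x => hAb _)
      (fun i => by rw [hev (fun t => a t - c) (by fun_prop), hA0])
      (integral_nonneg fun t => sq_nonneg _)
      (fun i => by rw [hev (fun t => (a t - c) ^ 2) (by fun_prop)]; exact hA2)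
      (fun i => by rw [hev (fun t => (a t - c) ^ 4) (by fun_prop)]; exact hA4)
      Finset.univ).2.2
    simpa using h
  have hSB : ∫ x : Fin M → ℝ, (∑ i, (b (x i) + c)) ^ 2 ∂(Measure.pi fun _ => μ)
      ≤ M * (u ^ (2 - q) * K) := by
    rw [integral_sum_sq_pi hBL hB0]
    gcongr
  have hSAint : Integrable (fun x : Fin M → ℝ => (∑ i, (a (x i) - c)) ^ 4)
      (Measure.pi fun _ => μ) := by
    refine Integrable.of_bound (C := (M * (2 * u)) ^ 4)
      (Measurable.aestronglyMeasurable (by fun_prop))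
      (Filter.Eventually.of_forall fun x => ?_)
    rw [Real.norm_eq_abs, abs_pow]
    gcongr
    calc |∑ i, (a (x i) - c)| ≤ ∑ i, |a (x i) - c| := Finset.abs_sum_le_sum_abs _ _
      _ ≤ ∑ i : Fin M, 2 * u := Finset.sum_le_sum fun i _ => hAb _
      _ = M * (2 * u) := by simp
  have hSBint := (memLp_sum_pi hBL M).integrable_sq
  have hpt : ∀ x : Fin M → ℝ,
      {x : Fin M → ℝ | u ≤ |∑ i, f (x i)|}.indicator (fun x => (∑ i, f (x i)) ^ 2) x
        ≤ 16 / u ^ 2 * (∑ i, (a (x i) - c)) ^ 4 + 4 * (∑ i, (b (x i) + c)) ^ 2 := fun x => by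
    by_cases hx : u ≤ |∑ i, f (x i)|
    · rw [Set.indicator_of_mem (by exact hx)]
      have hsum : ∑ i, f (x i) = ∑ i, (a (x i) - c) + ∑ i, (b (x i) + c) := by
        rw [← Finset.sum_add_distrib]
        exact Finset.sum_congr rfl fun i _ => by simp only [hb]; ring
      rw [hsum] at hx ⊢
      generalize ∑ i, (a (x i) - c) = A at hx ⊢
      generalize ∑ i, (b (x i) + c) = B at hx ⊢
      exact add_sq_le_of_le_abs_add hu hx
    · rw [Set.indicator_of_notMem (by exact hx)]
      positivity
  have huq : u ^ (4 - q) = u ^ (2 - q) * u ^ 2 := by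
    rw [← Real.rpow_natCast u 2, ← Real.rpow_add hu]
    norm_num
    ring_nf
  calc _ ≤ ∫ x : Fin M → ℝ, (16 / u ^ 2 * (∑ i, (a (x i) - c)) ^ 4
          + 4 * (∑ i, (b (x i) + c)) ^ 2) ∂(Measure.pi fun _ => μ) :=
        integral_mono_of_nonneg
          (Filter.Eventually.of_forall fun x =>
            Set.indicator_nonneg (fun _ _ => sq_nonneg _) x)
          ((hSAint.const_mul _).fun_add (hSBint.const_mul _)) (Filter.Eventually.of_forall hpt)
    _ = 16 / u ^ 2 * (∫ x : Fin M → ℝ, (∑ i, (a (x i) - c)) ^ 4 ∂(Measure.pi fun _ => μ))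
          + 4 * ∫ x : Fin M → ℝ, (∑ i, (b (x i) + c)) ^ 2 ∂(Measure.pi fun _ => μ) := by
        rw [integral_add (hSAint.const_mul _) (hSBint.const_mul _), integral_const_mul,
          integral_const_mul]
    _ ≤ 16 / u ^ 2 * (M * (16 * (u ^ (4 - q) * K)) + 3 * (M : ℝ) ^ 2 * v ^ 2)
          + 4 * (M * (u ^ (2 - q) * K)) := by gcongr
    _ = _ := by
        rw [huq]
        field_simp
        ring

/-- The antithetic difference of the positive part. -/
lemma antithetic_cases (e₁ e₂ m : ℝ) :
    let G := max 0 ((e₁ + e₂) / 2) - (1 / 2) * max 0 e₁ - (1 / 2) * max 0 e₂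
    G = 0 ∨ (|m| ≤ |e₁ - m| ∧ |G| ≤ |e₁ - m|) ∨ (|m| ≤ |e₂ - m| ∧ |G| ≤ |e₂ - m|) := by
  intro G
  rcases le_total 0 e₁ with h1 | h1 <;> rcases le_total 0 e₂ with h2 | h2
  · left
    simp only [G, max_eq_right h1, max_eq_right h2,
      max_eq_right (by linarith : 0 ≤ (e₁ + e₂) / 2)]
    ring
  · right
    rcases le_total 0 m with hm | hm
    · right
      simp only [G, max_eq_right h1, max_eq_left h2]
      rw [abs_of_nonneg hm, abs_of_nonpos (by linarith : e₂ - m ≤ 0)]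
      refine ⟨by linarith, abs_le.2 ⟨?_, ?_⟩⟩ <;>
        rcases max_cases 0 ((e₁ + e₂) / 2) with ⟨h, _⟩ | ⟨h, _⟩ <;> rw [h] <;> linarith
    · left
      simp only [G, max_eq_right h1, max_eq_left h2]
      rw [abs_of_nonpos hm, abs_of_nonneg (by linarith : 0 ≤ e₁ - m)]
      refine ⟨by linarith, abs_le.2 ⟨?_, ?_⟩⟩ <;>
        rcases max_cases 0 ((e₁ + e₂) / 2) with ⟨h, _⟩ | ⟨h, _⟩ <;> rw [h] <;> linarith
  · right
    rcases le_total 0 m with hm | hm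
    · left
      simp only [G, max_eq_left h1, max_eq_right h2]
      rw [abs_of_nonneg hm, abs_of_nonpos (by linarith : e₁ - m ≤ 0)]
      refine ⟨by linarith, abs_le.2 ⟨?_, ?_⟩⟩ <;>
        rcases max_cases 0 ((e₁ + e₂) / 2) with ⟨h, _⟩ | ⟨h, _⟩ <;> rw [h] <;> linarith
    · right
      simp only [G, max_eq_left h1, max_eq_right h2]
      rw [abs_of_nonpos hm, abs_of_nonneg (by linarith : 0 ≤ e₂ - m)]
      refine ⟨by linarith, abs_le.2 ⟨?_, ?_⟩⟩ <;>
        rcases max_cases 0 ((e₁ + e₂) / 2) with ⟨h, _⟩ | ⟨h, _⟩ <;> rw [h] <;> linarith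
  · left
    simp only [G, max_eq_left h1, max_eq_left h2,
      max_eq_left (by linarith : (e₁ + e₂) / 2 ≤ 0)]
    ring

lemma rpow_neg_le_of_one_le {x p : ℝ} (hx : 1 ≤ x) (hp0 : 0 ≤ p) (hp : p ≤ 2) :
    x ^ (-p) ≤ 4 * (1 + x) ^ (-p) := by
  have h1 : (2 * x) ^ (-p) ≤ (1 + x) ^ (-p) :=
    Real.rpow_le_rpow_of_nonpos (by linarith) (by linarith) (by linarith)
  rw [Real.mul_rpow (by norm_num) (by linarith)] at h1
  have h2 : (2 : ℝ) ^ (-2 : ℝ) ≤ 2 ^ (-p) :=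
    Real.rpow_le_rpow_of_exponent_le (by norm_num) (by linarith)
  have h3 : (2 : ℝ) ^ (-2 : ℝ) = 1 / 4 := by
    rw [Real.rpow_neg (by norm_num)]; norm_num
  have := mul_le_mul_of_nonneg_right (h3 ▸ h2) (by positivity : 0 ≤ x ^ (-p))
  linarith

lemma one_le_four_mul_rpow_neg {x p : ℝ} (hx0 : 0 ≤ x) (hx : x ≤ 1) (hp0 : 0 ≤ p)
    (hp : p ≤ 2) : 1 ≤ 4 * (1 + x) ^ (-p) := by
  have h := rpow_neg_le_of_one_le le_rfl hp0 hp
  rw [Real.one_rpow] at h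
  have : (1 + 1 : ℝ) ^ (-p) ≤ (1 + x) ^ (-p) :=
    Real.rpow_le_rpow_of_nonpos (by linarith) (by linarith) (by linarith)
  linarith

/-- Truncated first and second moments of the error of a Monte Carlo average. -/
lemma integral_average_indicator_le {μ : Measure ℝ} [IsProbabilityMeasure μ] {m s q κ δ : ℝ}
    (hf : MemLp (fun t => t - m) 2 μ) (h0 : ∫ t, (t - m) ∂μ = 0)
    (hs2 : ∫ t, (t - m) ^ 2 ∂μ = s ^ 2) (hs : 0 < s) (hδ : δ = |m| / s)
    (hq2 : 2 < q) (hq3 : q ≤ 3) (hK : Integrable (fun t => |t - m| ^ q) μ) (hκ0 : 0 ≤ κ)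
    (hκ : ∫ t, |t - m| ^ q ∂μ ≤ κ * s ^ q) {M : ℕ} (hM : 1 ≤ M) :
    (Integrable ({x : Fin M → ℝ | |m| ≤ |(∑ i, x i) / M - m|}.indicator
        fun x => |(∑ i, x i) / M - m|) (Measure.pi fun _ => μ) ∧
      ∫ x, {x : Fin M → ℝ | |m| ≤ |(∑ i, x i) / M - m|}.indicator
        (fun x => |(∑ i, x i) / M - m|) x ∂(Measure.pi fun _ => μ)
        ≤ (200 + 1040 * κ) * (s / √M * (1 + √M * δ) ^ (-(q - 1)))) ∧
    (Integrable ({x : Fin M → ℝ | |m| ≤ |(∑ i, x i) / M - m|}.indicator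
        fun x => ((∑ i, x i) / M - m) ^ 2) (Measure.pi fun _ => μ) ∧
      ∫ x, {x : Fin M → ℝ | |m| ≤ |(∑ i, x i) / M - m|}.indicator
        (fun x => ((∑ i, x i) / M - m) ^ 2) x ∂(Measure.pi fun _ => μ)
        ≤ (200 + 1040 * κ) * (s ^ 2 / M * ((1 + √M * δ) ^ (-2 : ℝ) + √M ^ (2 - q)))) := by
  have hMpos : (0 : ℝ) < M := by exact_mod_cast hM
  set r := √(M : ℝ) with hr
  have hr0 : 0 < r := Real.sqrt_pos.2 hMpos
  have hrM : (M : ℝ) = r ^ 2 := (Real.sq_sqrt hMpos.le).symm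
  have hr1 : 1 ≤ r := Real.one_le_sqrt.2 (by exact_mod_cast hM)
  set P : Measure (Fin M → ℝ) := Measure.pi fun _ => μ with hP
  set Z : (Fin M → ℝ) → ℝ := fun x => (∑ i, x i) / M - m with hZ
  have hSZ : ∀ x : Fin M → ℝ, ∑ i, (x i - m) = M * Z x := fun x => by
    simp only [hZ, Finset.sum_sub_distrib, Finset.sum_const, Finset.card_univ, Fintype.card_fin,
      nsmul_eq_mul]
    field_simp
  have hZL : MemLp Z 2 P := by
    have := (memLp_sum_pi hf M).const_mul (M : ℝ)⁻¹
    refine this.congr_norm (by fun_prop) (Filter.Eventually.of_forall fun x => ?_)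
    rw [hSZ, inv_mul_cancel_left₀ hMpos.ne']
  have hZ2 : ∫ x, Z x ^ 2 ∂P = s ^ 2 / M := by
    have h := integral_sum_sq_pi hf h0 M
    simp only [hSZ, mul_pow, integral_const_mul, hs2] at h
    rw [eq_div_iff hMpos.ne']
    have : (M : ℝ) * ((∫ x, Z x ^ 2 ∂P) * M) = M * s ^ 2 := by linarith
    exact mul_left_cancel₀ hMpos.ne' this
  set E : Set (Fin M → ℝ) := {x | |m| ≤ |Z x|} with hE
  have hEm : MeasurableSet E := measurableSet_le measurable_const (by fun_prop)
  have hI1 : Integrable (E.indicator fun x => |Z x|) P :=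
    (hZL.integrable one_le_two).abs.indicator hEm
  have hI2 : Integrable (E.indicator fun x => Z x ^ 2) P := hZL.integrable_sq.indicator hEm
  have hB2 : ∫ x, E.indicator (fun x => Z x ^ 2) x ∂P ≤ s ^ 2 / M := by
    rw [← hZ2]
    exact integral_mono hI2 hZL.integrable_sq
      fun x => Set.indicator_le_self' (fun _ _ => sq_nonneg _) x
  have hδ0 : 0 ≤ δ := by rw [hδ]; positivity
  set x := r * δ with hx
  have hx0 : 0 ≤ x := by positivity
  have hmx : |m| = x * s / r := by rw [hx, hδ]; field_simp
  have hT2 : 1 ≤ x → ∫ x, E.indicator (fun x => Z x ^ 2) x ∂P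
      ≤ s ^ 2 / M * (48 * x ^ (-2 : ℝ) + 260 * κ * r ^ (2 - q) * x ^ (2 - q)) := fun hx1 => by
    have hxp : 0 < x := by linarith
    have hmp : 0 < |m| := by rw [hmx]; positivity
    have h := integral_sum_sq_indicator_le (u := M * |m|) (f := fun t => t - m) (by fun_prop)
      hf h0 hq2.le (by linarith) hK (by positivity) M
    have e : ∀ y : Fin M → ℝ, {x : Fin M → ℝ | M * |m| ≤ |∑ i, (x i - m)|}.indicator
        (fun x => (∑ i, (x i - m)) ^ 2) y = M ^ 2 * E.indicator (fun x => Z x ^ 2) y := fun y => by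
      simp only [hSZ, abs_mul, Nat.abs_cast, mul_le_mul_iff_right₀ hMpos, mul_pow]
      by_cases hy : y ∈ E
      · rw [Set.indicator_of_mem hy, Set.indicator_of_mem (by exact hy)]
      · rw [Set.indicator_of_notMem hy, Set.indicator_of_notMem (by exact hy), mul_zero]
    simp only [e, integral_const_mul, hs2] at h
    have hu : (M : ℝ) * |m| = r * x * s := by rw [hmx, hrM]; field_simp
    have hxm2 : x ^ (-2 : ℝ) = (x ^ 2)⁻¹ := by
      rw [Real.rpow_neg hx0]; norm_num
    have hsq : s ^ (2 - q) * s ^ q = s ^ 2 := by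
      rw [← Real.rpow_add hs]; norm_num
    have hpow : (r * x * s) ^ (2 - q) = r ^ (2 - q) * x ^ (2 - q) * s ^ (2 - q) := by
      rw [Real.mul_rpow (by positivity) hs.le, Real.mul_rpow hr0.le hx0]
    have hle : 260 * (M : ℝ) * (M * |m|) ^ (2 - q) * (∫ t, |t - m| ^ q ∂μ)
        ≤ 260 * M * (M * |m|) ^ (2 - q) * (κ * s ^ q) := by gcongr
    have hfin : 260 * (M : ℝ) * (M * |m|) ^ (2 - q) * (κ * s ^ q)
        + 48 * M ^ 2 * (s ^ 2) ^ 2 / (M * |m|) ^ 2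
        = M ^ 2 * (s ^ 2 / M * (48 * x ^ (-2 : ℝ) + 260 * κ * r ^ (2 - q) * x ^ (2 - q))) := by
      rw [hu, hpow, hxm2]
      have : 260 * (M : ℝ) * (r ^ (2 - q) * x ^ (2 - q) * s ^ (2 - q)) * (κ * s ^ q)
        = 260 * (M : ℝ) * (r ^ (2 - q) * x ^ (2 - q)) * κ * s ^ 2 := by rw [← hsq]; ring
      rw [this, hrM]
      field_simp
      ring
    have h' := h.trans (add_le_add_left hle _)
    rw [hfin] at h'
    exact le_of_mul_le_mul_left h' (by positivity)
  refine ⟨⟨hI1, ?_⟩, hI2, ?_⟩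
  · rcases le_total x 1 with hx1 | hx1
    · have hb : ∫ x, E.indicator (fun x => |Z x|) x ∂P ≤ s / r := by
        have hpt : ∀ x, E.indicator (fun x => |Z x|) x ≤ r / (2 * s) * Z x ^ 2 + s / (2 * r) :=
          fun x => by
            refine (Set.indicator_le_self' (fun _ _ => abs_nonneg _) x).trans ?_
            have : r / (2 * s) * Z x ^ 2 + s / (2 * r) - |Z x|
                = (r * |Z x| - s) ^ 2 / (2 * r * s) := by
              rw [← sq_abs (Z x)]; field_simp; ring
            have : 0 ≤ (r * |Z x| - s) ^ 2 / (2 * r * s) := by positivity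
            linarith
        have := integral_mono hI1 ((hZL.integrable_sq.const_mul _).fun_add (integrable_const _)) hpt
        rw [integral_add (hZL.integrable_sq.const_mul _) (integrable_const _),
          integral_const_mul, hZ2] at this
        simp only [integral_const, probReal_univ, one_smul] at this
        refine this.trans_eq ?_
        rw [hrM]; field_simp; ring
      have h4 := one_le_four_mul_rpow_neg hx0 hx1 (by linarith : 0 ≤ q - 1) (by linarith)
      have h5 := mul_le_mul_of_nonneg_left h4 (by positivity : 0 ≤ s / r)
      have h6 : 0 ≤ s / r * (1 + x) ^ (-(q - 1)) := by positivity
      nlinarith [mul_nonneg hκ0 h6]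
    · have hxp : 0 < x := by linarith
      have hmp : 0 < |m| := by rw [hmx]; positivity
      have hb : ∫ x, E.indicator (fun x => |Z x|) x ∂P
          ≤ |m|⁻¹ * ∫ x, E.indicator (fun x => Z x ^ 2) x ∂P := by
        rw [← integral_const_mul]
        refine integral_mono hI1 (hI2.const_mul _) fun y => ?_
        by_cases hy : y ∈ E
        · simp only [Set.indicator_of_mem hy]
          rw [← sq_abs, inv_mul_eq_div, le_div_iff₀ hmp, sq]
          exact mul_le_mul_of_nonneg_left hy (abs_nonneg _)
        · simp [Set.indicator_of_notMem hy]
      have hb2 := hb.trans (mul_le_mul_of_nonneg_left (hT2 hx1) (by positivity))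
      have e1 : |m|⁻¹ * (s ^ 2 / M * (48 * x ^ (-2 : ℝ) + 260 * κ * r ^ (2 - q) * x ^ (2 - q)))
          = s / r * (48 * (x ^ (-2 : ℝ) * x⁻¹)
            + 260 * κ * r ^ (2 - q) * (x ^ (2 - q) * x⁻¹)) := by
        rw [hmx, hrM]; field_simp
      have e2 : x ^ (2 - q) * x⁻¹ = x ^ (-(q - 1)) := by
        rw [← Real.rpow_neg_one, ← Real.rpow_add hxp]; ring_nf
      have e3 : x ^ (-2 : ℝ) * x⁻¹ ≤ x ^ (-(q - 1)) := by
        rw [← Real.rpow_neg_one, ← Real.rpow_add hxp]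
        exact Real.rpow_le_rpow_of_exponent_le hx1 (by linarith)
      have hr2 : r ^ (2 - q) ≤ 1 := Real.rpow_le_one_of_one_le_of_nonpos hr1 (by linarith)
      have h4 := rpow_neg_le_of_one_le hx1 (by linarith : 0 ≤ q - 1) (by linarith)
      have e4 := e3.trans h4
      rw [e1, e2] at hb2
      calc _ ≤ _ := hb2
        _ ≤ s / r * (48 * (4 * (1 + x) ^ (-(q - 1)))
            + 260 * κ * 1 * (4 * (1 + x) ^ (-(q - 1)))) := by
          gcongr
        _ ≤ _ := by
          have h6 : 0 ≤ s / r * (1 + x) ^ (-(q - 1)) := by positivity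
          linarith
  · have h7 : 0 ≤ r ^ (2 - q) := by positivity
    rcases le_total x 1 with hx1 | hx1
    · have h4 := one_le_four_mul_rpow_neg hx0 hx1 zero_le_two le_rfl
      have h6 : 0 ≤ (1 + x) ^ (-2 : ℝ) := by positivity
      have h8 : 1 ≤ (200 + 1040 * κ) * ((1 + x) ^ (-2 : ℝ) + r ^ (2 - q)) := by
        nlinarith [mul_nonneg hκ0 h6, mul_nonneg hκ0 h7]
      have := mul_le_mul_of_nonneg_left h8 (by positivity : 0 ≤ s ^ 2 / M)
      linarith
    · have h4 := rpow_neg_le_of_one_le hx1 zero_le_two le_rfl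
      have h5 : x ^ (2 - q) ≤ 1 := Real.rpow_le_one_of_one_le_of_nonpos hx1 (by linarith)
      have h6 : 0 ≤ (1 + x) ^ (-2 : ℝ) := by positivity
      calc _ ≤ _ := hT2 hx1
        _ ≤ s ^ 2 / M * (48 * (4 * (1 + x) ^ (-2 : ℝ)) + 260 * κ * r ^ (2 - q) * 1) := by
          gcongr
        _ ≤ s ^ 2 / M * ((200 + 1040 * κ) * ((1 + x) ^ (-2 : ℝ) + r ^ (2 - q))) := by
          gcongr
          nlinarith [mul_nonneg hκ0 h6, mul_nonneg hκ0 h7]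
        _ = _ := by ring

/-- A bound on each factor gives a bound for the antithetic difference over the product. -/
lemma lintegral_antithetic_le {Ω : Type*} [MeasurableSpace Ω] {P : Measure Ω}
    [IsProbabilityMeasure P] {e : Ω → ℝ} (he : Measurable e) (m : ℝ) {A₁ A₂ : ℝ}
    (h₁ : Integrable ({x | |m| ≤ |e x - m|}.indicator fun x => |e x - m|) P ∧
      ∫ x, {x | |m| ≤ |e x - m|}.indicator (fun x => |e x - m|) x ∂P ≤ A₁)
    (h₂ : Integrable ({x | |m| ≤ |e x - m|}.indicator fun x => (e x - m) ^ 2) P ∧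
      ∫ x, {x | |m| ≤ |e x - m|}.indicator (fun x => (e x - m) ^ 2) x ∂P ≤ A₂) :
    ∫⁻ p : Ω × Ω, ENNReal.ofReal |max 0 ((e p.1 + e p.2) / 2) - (1 / 2) * max 0 (e p.1)
        - (1 / 2) * max 0 (e p.2)| ∂(P.prod P) ≤ ENNReal.ofReal (2 * A₁) ∧
    ∫⁻ p : Ω × Ω, ENNReal.ofReal ((max 0 ((e p.1 + e p.2) / 2) - (1 / 2) * max 0 (e p.1)
        - (1 / 2) * max 0 (e p.2)) ^ 2) ∂(P.prod P) ≤ ENNReal.ofReal (2 * A₂) := by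
  set E : Set Ω := {x | |m| ≤ |e x - m|} with hE
  have hEm : MeasurableSet E := measurableSet_le measurable_const (by fun_prop)
  have key : ∀ (f : Ω → ℝ), Measurable f → (∀ x, 0 ≤ f x) → ∀ (g : Ω × Ω → ℝ) (A : ℝ),
      Integrable (E.indicator f) P ∧ ∫ x, E.indicator f x ∂P ≤ A →
      (∀ p, g p ≤ 0 ∨ (p.1 ∈ E ∧ g p ≤ f p.1) ∨ (p.2 ∈ E ∧ g p ≤ f p.2)) →
      ∫⁻ p, ENNReal.ofReal (g p) ∂(P.prod P) ≤ ENNReal.ofReal (2 * A) := by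
    intro f hf hf0 g A hA hg
    have hnn : ∀ x, 0 ≤ E.indicator f x := fun x => Set.indicator_nonneg (fun _ _ => hf0 _) x
    have hm : Measurable fun x => ENNReal.ofReal (E.indicator f x) :=
      (hf.indicator hEm).ennreal_ofReal
    have hA0 : 0 ≤ A := (integral_nonneg hnn).trans hA.2
    have hle : ∫⁻ x, ENNReal.ofReal (E.indicator f x) ∂P ≤ ENNReal.ofReal A := by
      rw [← ofReal_integral_eq_lintegral_ofReal hA.1 (Filter.Eventually.of_forall hnn)]
      exact ENNReal.ofReal_le_ofReal hA.2
    calc ∫⁻ p, ENNReal.ofReal (g p) ∂(P.prod P)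
        ≤ ∫⁻ p : Ω × Ω, (ENNReal.ofReal (E.indicator f p.1)
            + ENNReal.ofReal (E.indicator f p.2)) ∂(P.prod P) := by
          refine lintegral_mono fun p => ?_
          rcases hg p with h | ⟨h, h'⟩ | ⟨h, h'⟩
          · simp [ENNReal.ofReal_of_nonpos h]
          · rw [Set.indicator_of_mem h]
            exact (ENNReal.ofReal_le_ofReal h').trans le_self_add
          · rw [Set.indicator_of_mem h]
            exact (ENNReal.ofReal_le_ofReal h').trans le_add_self
      _ = ∫⁻ x, ENNReal.ofReal (E.indicator f x) ∂P
            + ∫⁻ x, ENNReal.ofReal (E.indicator f x) ∂P := by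
          refine (lintegral_add_left (hm.comp measurable_fst) _).trans ?_
          congr 1
          · exact measurePreserving_fst.lintegral_comp hm
          · exact measurePreserving_snd.lintegral_comp hm
      _ ≤ ENNReal.ofReal A + ENNReal.ofReal A := add_le_add hle hle
      _ = _ := by rw [← ENNReal.ofReal_add hA0 hA0, two_mul]
  constructor
  · refine key (fun x => |e x - m|) (by fun_prop) (fun x => abs_nonneg _) _ A₁ h₁ fun p => ?_
    rcases antithetic_cases (e p.1) (e p.2) m with h | h | h
    · left; rw [h, abs_zero]
    · exact Or.inr (Or.inl h)
    · exact Or.inr (Or.inr h)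
  · refine key (fun x => (e x - m) ^ 2) (by fun_prop) (fun x => sq_nonneg _) _ A₂ h₂ fun p => ?_
    rcases antithetic_cases (e p.1) (e p.2) m with h | h | h
    · left; rw [h]; norm_num
    · exact Or.inr (Or.inl ⟨h.1, sq_le_sq.2 h.2⟩)
    · exact Or.inr (Or.inr ⟨h.1, sq_le_sq.2 h.2⟩)

lemma setLIntegral_rpow_le_of_density {𝓨 : Type*} [MeasurableSpace 𝓨] {ν : Measure 𝓨}
    {δ : 𝓨 → ℝ} (hδ0 : ∀ y, 0 ≤ δ y) (hδ : Measurable δ) {ρ : ℝ → ℝ} {ρ₀ δ₀ : ℝ}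
    (hρ₀ : 0 < ρ₀)
    (hdensity : ν.map δ = volume.withDensity fun t => ENNReal.ofReal (ρ t))
    (hρ : ∀ t ∈ Set.Icc (0 : ℝ) δ₀, ρ t ≤ ρ₀) {p r : ℝ} (hp : 1 < p) (hr : 0 < r) :
    ∫⁻ y in {y | δ y < δ₀}, ENNReal.ofReal ((1 + r * δ y) ^ (-p)) ∂ν
      ≤ ENNReal.ofReal (ρ₀ * (r⁻¹ * ∫ t : ℝ, (1 + ‖t‖) ^ (-p))) := by
  have hle : (ν.map δ).restrict (Set.Icc 0 δ₀) ≤ ENNReal.ofReal ρ₀ • volume := by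
    refine Measure.le_iff.2 fun A hA => ?_
    rw [Measure.restrict_apply hA, hdensity, withDensity_apply _ (hA.inter measurableSet_Icc)]
    calc _ ≤ ∫⁻ _ in A ∩ Set.Icc 0 δ₀, ENNReal.ofReal ρ₀ :=
          setLIntegral_mono measurable_const fun t ht => ENNReal.ofReal_le_ofReal (hρ t ht.2)
      _ = ENNReal.ofReal ρ₀ * volume (A ∩ Set.Icc 0 δ₀) := setLIntegral_const _ _
      _ ≤ _ := by
        rw [Measure.smul_apply, smul_eq_mul]
        gcongr
        exact Set.inter_subset_left
  have hint : Integrable fun t : ℝ => (1 + ‖t‖) ^ (-p) :=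
    integrable_one_add_norm (by simpa using hp)
  set H : ℝ → ℝ≥0∞ := fun t => ENNReal.ofReal ((1 + ‖r * t‖) ^ (-p)) with hH
  have hHm : Measurable H := by fun_prop
  calc ∫⁻ y in {y | δ y < δ₀}, ENNReal.ofReal ((1 + r * δ y) ^ (-p)) ∂ν
      ≤ ∫⁻ y in δ ⁻¹' Set.Icc 0 δ₀, H (δ y) ∂ν := by
        refine (lintegral_mono_set (t := δ ⁻¹' Set.Icc 0 δ₀)
          fun y hy => ⟨hδ0 y, le_of_lt hy⟩).trans
          (lintegral_mono fun y => ?_)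
        simp only [hH]
        rw [Real.norm_of_nonneg (mul_nonneg hr.le (hδ0 y))]
    _ = ∫⁻ t in Set.Icc 0 δ₀, H t ∂(ν.map δ) := by
        rw [setLIntegral_map measurableSet_Icc hHm hδ]
    _ ≤ ∫⁻ t, H t ∂(ENNReal.ofReal ρ₀ • volume) := lintegral_mono' hle le_rfl
    _ = ENNReal.ofReal ρ₀ * ENNReal.ofReal (r⁻¹ * ∫ t : ℝ, (1 + ‖t‖) ^ (-p)) := by
        rw [lintegral_smul_measure, smul_eq_mul, hH,
          ← ofReal_integral_eq_lintegral_ofReal (hint.comp_mul_left' hr.ne')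
            (Filter.Eventually.of_forall fun t => by positivity),
          Measure.integral_comp_mul_left (fun t : ℝ => (1 + ‖t‖) ^ (-p)),
          abs_of_pos (inv_pos.2 hr), smul_eq_mul]
    _ = _ := by rw [← ENNReal.ofReal_mul hρ₀.le]

lemma lintegral_weighted_rpow_le {𝓨 : Type*} [MeasurableSpace 𝓨] {ν : Measure 𝓨}
    {δ : 𝓨 → ℝ} (hδ0 : ∀ y, 0 ≤ δ y) (hδ : Measurable δ) {ρ : ℝ → ℝ}
    [IsProbabilityMeasure ν] {ρ₀ δ₀ : ℝ} (hρ₀ : 0 < ρ₀) (hδ₀ : 0 < δ₀)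
    (hdensity : ν.map δ = volume.withDensity fun t => ENNReal.ofReal (ρ t))
    (hρ : ∀ t ∈ Set.Icc (0 : ℝ) δ₀, ρ t ≤ ρ₀) {p r b W : ℝ} (hp : 1 < p) (hr : 0 < r)
    (hb : 0 ≤ b) {w : 𝓨 → ℝ} (hw0 : ∀ y, 0 ≤ w y) (hw : Integrable w ν)
    (hW0 : 0 ≤ W) (hW : ∀ y, δ y < δ₀ → w y ≤ W) :
    ∫⁻ y, ENNReal.ofReal (w y * ((1 + r * δ y) ^ (-p) + b)) ∂ν
      ≤ ENNReal.ofReal (W * (ρ₀ * (r⁻¹ * ∫ t : ℝ, (1 + ‖t‖) ^ (-p)) + b)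
          + (1 / (r * δ₀) + b) * ∫ y, w y ∂ν) := by
  have hS : MeasurableSet {y | δ y < δ₀} := measurableSet_lt hδ measurable_const
  have hJ : 0 ≤ ∫ t : ℝ, (1 + ‖t‖) ^ (-p) := integral_nonneg fun t => by positivity
  have hV : 0 ≤ ∫ y, w y ∂ν := integral_nonneg hw0
  rw [← lintegral_add_compl _ hS, ENNReal.ofReal_add (by positivity) (by positivity)]
  refine add_le_add ?_ ?_
  · calc _ ≤ ∫⁻ y in {y | δ y < δ₀}, ENNReal.ofReal W *
            (ENNReal.ofReal ((1 + r * δ y) ^ (-p)) + ENNReal.ofReal b) ∂ν := by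
          refine setLIntegral_mono (by fun_prop) fun y hy => ?_
          have := hδ0 y
          rw [← ENNReal.ofReal_add (by positivity) hb, ← ENNReal.ofReal_mul hW0]
          apply ENNReal.ofReal_le_ofReal
          have := hW y hy
          gcongr
      _ = ENNReal.ofReal W * (∫⁻ y in {y | δ y < δ₀}, ENNReal.ofReal ((1 + r * δ y) ^ (-p)) ∂ν
            + ENNReal.ofReal b * ν {y | δ y < δ₀}) := by
          rw [lintegral_const_mul _ (by fun_prop), lintegral_add_left (by fun_prop),
            setLIntegral_const]
      _ ≤ ENNReal.ofReal W * (ENNReal.ofReal (ρ₀ * (r⁻¹ * ∫ t : ℝ, (1 + ‖t‖) ^ (-p)))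
            + ENNReal.ofReal b * 1) := by
          gcongr
          · exact setLIntegral_rpow_le_of_density hδ0 hδ hρ₀ hdensity hρ hp hr
          · exact prob_le_one
      _ = _ := by
          rw [mul_one, ← ENNReal.ofReal_add (by positivity) hb, ← ENNReal.ofReal_mul hW0]
  · calc _ ≤ ∫⁻ y in {y | δ y < δ₀}ᶜ, ENNReal.ofReal ((1 / (r * δ₀) + b) * w y) ∂ν := by
          refine setLIntegral_mono' hS.compl fun y hy => ENNReal.ofReal_le_ofReal ?_
          have hy' : δ₀ ≤ δ y := not_lt.1 hy
          have hrd : r * δ₀ ≤ r * δ y := by gcongr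
          have hpos : 0 < r * δ₀ := by positivity
          have h1 : (1 + r * δ y) ^ (-p) ≤ 1 / (r * δ₀) := by
            calc (1 + r * δ y) ^ (-p) ≤ (1 + r * δ y) ^ (-1 : ℝ) :=
                  Real.rpow_le_rpow_of_exponent_le (by linarith) (by linarith)
              _ = 1 / (1 + r * δ y) := by rw [Real.rpow_neg_one, one_div]
              _ ≤ 1 / (r * δ₀) := one_div_le_one_div_of_le hpos (by linarith)
          have := hw0 y
          rw [mul_comm]
          gcongr
      _ ≤ ∫⁻ y, ENNReal.ofReal ((1 / (r * δ₀) + b) * w y) ∂ν := setLIntegral_le_lintegral _ _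
      _ = _ := by
          rw [← ofReal_integral_eq_lintegral_ofReal (hw.const_mul _)
            (Filter.Eventually.of_forall fun y => mul_nonneg (by positivity) (hw0 y)),
            integral_const_mul]

lemma integral_rpow_min_le {μ : Measure ℝ} [IsProbabilityMeasure μ] {f : ℝ → ℝ}
    (hf : Measurable f) {s q q' k : ℝ} (hs : 0 < s) (hq0 : 0 ≤ q') (hq : q' ≤ q)
    (hint : Integrable (fun t => |f t| ^ q) μ) (hk : ∫ t, |f t| ^ q ∂μ ≤ k * s ^ q) :
    Integrable (fun t => |f t| ^ q') μ ∧ ∫ t, |f t| ^ q' ∂μ ≤ (1 + |k|) * s ^ q' := by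
  have hpt : ∀ t, |f t| ^ q' ≤ s ^ q' + s ^ (q' - q) * |f t| ^ q := fun t => by
    rcases le_total |f t| s with h | h
    · have h1 := Real.rpow_le_rpow (abs_nonneg _) h hq0
      have : 0 ≤ s ^ (q' - q) * |f t| ^ q := by positivity
      linarith
    · have hpos : 0 < |f t| := hs.trans_le h
      have h1 : |f t| ^ q' = |f t| ^ (q' - q) * |f t| ^ q := by
        rw [← Real.rpow_add hpos]; ring_nf
      have h2 := Real.rpow_le_rpow_of_nonpos hs h (by linarith : q' - q ≤ 0)
      have h3 : |f t| ^ (q' - q) * |f t| ^ q ≤ s ^ (q' - q) * |f t| ^ q := by gcongr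
      have : 0 ≤ s ^ q' := by positivity
      linarith
  have hbd := (integrable_const (μ := μ) (s ^ q')).fun_add (hint.const_mul (s ^ (q' - q)))
  have hI : Integrable (fun t => |f t| ^ q') μ :=
    hbd.mono' (by fun_prop) (Filter.Eventually.of_forall fun t => by
      rw [Real.norm_of_nonneg (by positivity)]; exact hpt t)
  refine ⟨hI, ?_⟩
  have h := integral_mono hI hbd hpt
  rw [integral_add (integrable_const _) (hint.const_mul _), integral_const_mul] at h
  simp only [integral_const, probReal_univ, one_smul] at h
  have e : s ^ (q' - q) * s ^ q = s ^ q' := by rw [← Real.rpow_add hs]; ring_nf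
  calc _ ≤ _ := h
    _ ≤ s ^ q' + s ^ (q' - q) * (|k| * s ^ q) := by
      gcongr
      exact hk.trans (by gcongr; exact le_abs_self k)
    _ = _ := by rw [← e]; ring

/-- Conditional bounds, given `Y = y`, on the antithetic difference. -/
lemma lintegral_antithetic_average_le {μ : Measure ℝ} [IsProbabilityMeasure μ]
    {m s δ q k : ℝ} (hm : m = ∫ t, t ∂μ) (hs : s = √(variance (fun t => t) μ))
    (hs0 : 0 < s) (hδ : δ = |m| / s) (hq : 2 < q)
    (hmom : Integrable (fun x => |x - m| ^ q) μ)
    (hk : (∫ x, |x - m| ^ q ∂μ) ≤ k * s ^ q) {M : ℕ} (hM : 1 ≤ M) :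
    ∫⁻ p : (Fin M → ℝ) × (Fin M → ℝ), ENNReal.ofReal
        |max 0 (((∑ n, p.1 n) / (M : ℝ) + (∑ n, p.2 n) / (M : ℝ)) / 2)
          - (1 / 2) * max 0 ((∑ n, p.1 n) / (M : ℝ))
          - (1 / 2) * max 0 ((∑ n, p.2 n) / (M : ℝ))|
        ∂((Measure.pi fun _ => μ).prod (Measure.pi fun _ => μ))
      ≤ ENNReal.ofReal (2 * ((200 + 1040 * (1 + |k|)) *
          (s / √M * (1 + √M * δ) ^ (-(min 3 q - 1))))) ∧
    ∫⁻ p : (Fin M → ℝ) × (Fin M → ℝ), ENNReal.ofReal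
        ((max 0 (((∑ n, p.1 n) / (M : ℝ) + (∑ n, p.2 n) / (M : ℝ)) / 2)
          - (1 / 2) * max 0 ((∑ n, p.1 n) / (M : ℝ))
          - (1 / 2) * max 0 ((∑ n, p.2 n) / (M : ℝ))) ^ 2)
        ∂((Measure.pi fun _ => μ).prod (Measure.pi fun _ => μ))
      ≤ ENNReal.ofReal (2 * ((200 + 1040 * (1 + |k|)) *
          (s ^ 2 / M * ((1 + √M * δ) ^ (-2 : ℝ) + √M ^ (2 - min 3 q))))) := by
  have hq2 : 2 < min 3 q := lt_min (by norm_num) hq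
  obtain ⟨hK, hKle⟩ := integral_rpow_min_le (q' := min 3 q) (f := fun t => t - m) (by fun_prop)
    hs0 (by linarith) (min_le_right _ _) hmom hk
  have hf : MemLp (fun t => t - m) 2 μ := by
    have hLq : MemLp (fun t => t - m) (ENNReal.ofReal q) μ := by
      rw [← integrable_norm_rpow_iff (by fun_prop) (by simp; linarith) ENNReal.ofReal_ne_top,
        ENNReal.toReal_ofReal (by linarith)]
      exact hmom
    refine hLq.mono_exponent ?_
    rw [← ENNReal.ofReal_ofNat]
    exact ENNReal.ofReal_le_ofReal hq.le
  have hid : Integrable (fun t : ℝ => t) μ := by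
    simpa using (hf.integrable one_le_two).fun_add (integrable_const m)
  have h0 : ∫ t, (t - m) ∂μ = 0 := by
    rw [integral_sub hid (integrable_const _)]
    simp [hm]
  have hs2 : ∫ t, (t - m) ^ 2 ∂μ = s ^ 2 := by
    rw [hs, Real.sq_sqrt (variance_nonneg _ _), variance_eq_integral (by fun_prop), hm]
  obtain ⟨h1, h2⟩ := integral_average_indicator_le hf h0 hs2 hs0 hδ hq2 (min_le_left _ _) hK
    (by positivity) hKle hM
  exact lintegral_antithetic_le (e := fun x : Fin M → ℝ => (∑ n, x n) / (M : ℝ))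
    (by fun_prop) m h1 h2

/-- Antithetic MLMC difference for the `max` functional: assume the
bounded-density assumption on `δ = d/σ`, the bounded-moment assumption `κ_q < ∞` with
`q > 2`, `E[σ²] < ∞`, and `σ ≤ σ₀` whenever `δ < δ₀`.  With `N_ℓ = N₀·2^ℓ` (`N₀ = 2M₀`
even) and, given `Y`, two conditionally independent Monte Carlo averages `Ê₁, Ê₂` of
`N_ℓ/2 = M₀·2^ℓ` samples each (modelled by the Markov kernels `κ ℓ`), the antithetic
difference `G_ℓ = max(0, (Ê₁+Ê₂)/2) − (1/2)max(0,Ê₁) − (1/2)max(0,Ê₂)` satisfies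
`E[|G_ℓ|] = O(N_ℓ^{-1})` and `E[G_ℓ²] = O(N_ℓ^{-min(3,q)/2})`. -/
theorem antithetic_max_mlmc {𝓨 : Type*} [MeasurableSpace 𝓨]
    (ν : Measure 𝓨) [IsProbabilityMeasure ν]
    (μ : 𝓨 → Measure ℝ) (hprob : ∀ y, IsProbabilityMeasure (μ y))
    (m s δ : 𝓨 → ℝ)
    (hm : ∀ y, m y = ∫ t, t ∂μ y)
    (hs : ∀ y, s y = Real.sqrt (variance (fun t => t) (μ y)))
    (hδ : ∀ y, δ y = |m y| / s y)
    (hmmeas : Measurable m) (hδmeas : Measurable δ) (hsmeas : Measurable s)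
    (ρ : ℝ → ℝ) (ρ₀ δ₀ : ℝ) (hρ₀ : 0 < ρ₀) (hδ₀ : 0 < δ₀)
    (hdensity : ν.map δ = MeasureTheory.volume.withDensity fun t => ENNReal.ofReal (ρ t))
    (hρbound : ∀ t ∈ Set.Icc (0 : ℝ) δ₀, ρ t ≤ ρ₀)
    (q : ℝ) (hq : 2 < q) (κq : ℝ)
    (hmom : ∀ y, Integrable (fun x => |x - m y| ^ q) (μ y))
    (hκq : ∀ y, (∫ x, |x - m y| ^ q ∂μ y) ≤ κq * s y ^ q)
    (hσ2 : Integrable (fun y => s y ^ 2) ν)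
    (σ₀ : ℝ) (hσ₀ : ∀ y, δ y < δ₀ → s y ≤ σ₀)
    (M₀ : ℕ) (hM₀ : 1 ≤ M₀)
    (κ : ∀ ℓ : ℕ, Kernel 𝓨 ((Fin (M₀ * 2 ^ ℓ) → ℝ) × (Fin (M₀ * 2 ^ ℓ) → ℝ)))
    [∀ ℓ, IsMarkovKernel (κ ℓ)]
    (hκ : ∀ (ℓ : ℕ) (y : 𝓨),
      κ ℓ y = (Measure.pi fun _ : Fin (M₀ * 2 ^ ℓ) => μ y).prod
                 (Measure.pi fun _ : Fin (M₀ * 2 ^ ℓ) => μ y)) :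
    ∃ c : ℝ, ∀ ℓ : ℕ,
      (∫⁻ p : 𝓨 × ((Fin (M₀ * 2 ^ ℓ) → ℝ) × (Fin (M₀ * 2 ^ ℓ) → ℝ)),
          ENNReal.ofReal
            |max 0 (((∑ n, p.2.1 n) / (M₀ * 2 ^ ℓ : ℝ)
                      + (∑ n, p.2.2 n) / (M₀ * 2 ^ ℓ : ℝ)) / 2)
              - (1 / 2) * max 0 ((∑ n, p.2.1 n) / (M₀ * 2 ^ ℓ : ℝ))
              - (1 / 2) * max 0 ((∑ n, p.2.2 n) / (M₀ * 2 ^ ℓ : ℝ))| ∂(ν ⊗ₘ κ ℓ))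
        ≤ ENNReal.ofReal (c * ((2 * M₀ : ℝ) * 2 ^ ℓ)⁻¹) ∧
      (∫⁻ p : 𝓨 × ((Fin (M₀ * 2 ^ ℓ) → ℝ) × (Fin (M₀ * 2 ^ ℓ) → ℝ)),
          ENNReal.ofReal
            ((max 0 (((∑ n, p.2.1 n) / (M₀ * 2 ^ ℓ : ℝ)
                       + (∑ n, p.2.2 n) / (M₀ * 2 ^ ℓ : ℝ)) / 2)
              - (1 / 2) * max 0 ((∑ n, p.2.1 n) / (M₀ * 2 ^ ℓ : ℝ))
              - (1 / 2) * max 0 ((∑ n, p.2.2 n) / (M₀ * 2 ^ ℓ : ℝ))) ^ 2) ∂(ν ⊗ₘ κ ℓ))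
        ≤ ENNReal.ofReal (c * ((2 * M₀ : ℝ) * 2 ^ ℓ) ^ (-(min 3 q) / 2)) := by
  have hs0 : ∀ y, 0 ≤ s y := fun y => hs y ▸ Real.sqrt_nonneg _
  have hδ0 : ∀ y, 0 ≤ δ y := fun y => hδ y ▸ div_nonneg (abs_nonneg _) (hs0 y)
  have hspos : ∀ᵐ y ∂ν, 0 < s y := by
    have hnull : ν.map δ {0} = 0 := by
      rw [hdensity]
      exact withDensity_absolutelyContinuous _ _ (measure_singleton 0)
    rw [Measure.map_apply hδmeas (measurableSet_singleton 0)] at hnull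
    filter_upwards [measure_eq_zero_iff_ae_notMem.1 hnull] with y hy
    refine (hs0 y).lt_of_ne fun h => hy ?_
    simp [hδ y, ← h]
  have hsint : Integrable s ν :=
    ((integrable_const (1 : ℝ)).fun_add hσ2).mono' hsmeas.aestronglyMeasurable
      (Filter.Eventually.of_forall fun y => by
        rw [Real.norm_of_nonneg (hs0 y)]
        nlinarith [sq_nonneg (s y - 1), sq_nonneg (s y)])
  have hq2 : 2 < min 3 q := lt_min (by norm_num) hq
  have hq3 : min 3 q ≤ 3 := min_le_left _ _
  set C := 2 * (200 + 1040 * (1 + |κq|)) with hC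
  have hC0 : 0 ≤ C := by positivity
  set J₁ := ∫ t : ℝ, (1 + ‖t‖) ^ (-(min 3 q - 1)) with hJ₁
  set J₂ := ∫ t : ℝ, (1 + ‖t‖) ^ (-2 : ℝ) with hJ₂
  have hJ₁0 : 0 ≤ J₁ := integral_nonneg fun t => by positivity
  have hJ₂0 : 0 ≤ J₂ := integral_nonneg fun t => by positivity
  set V₁ := ∫ y, s y ∂ν with hV₁
  set V₂ := ∫ y, s y ^ 2 ∂ν with hV₂
  have hV₁0 : 0 ≤ V₁ := integral_nonneg hs0
  have hV₂0 : 0 ≤ V₂ := integral_nonneg fun y => sq_nonneg _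
  set c₁ := C * (|σ₀| * (ρ₀ * J₁) + V₁ / δ₀) with hc₁
  set c₂ := C * (|σ₀| ^ 2 * (ρ₀ * J₂ + 1) + (1 / δ₀ + 1) * V₂) with hc₂
  have hc₁0 : 0 ≤ c₁ := by positivity
  have hc₂0 : 0 ≤ c₂ := by positivity
  have hW : ∀ y, δ y < δ₀ → s y ≤ |σ₀| := fun y hy => (hσ₀ y hy).trans (le_abs_self _)
  refine ⟨2 * c₁ + 4 * c₂, fun ℓ => ?_⟩
  have hM : 1 ≤ M₀ * 2 ^ ℓ := Nat.one_le_iff_ne_zero.2 (by positivity)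
  have hcast : ((M₀ * 2 ^ ℓ : ℕ) : ℝ) = (M₀ * 2 ^ ℓ : ℝ) := by push_cast; ring
  have hMr : (1 : ℝ) ≤ (M₀ * 2 ^ ℓ : ℝ) := by rw [← hcast]; exact_mod_cast hM
  have hcond := fun y (hy : 0 < s y) => by
    have := hprob y
    have h := lintegral_antithetic_average_le (hm y) (hs y) hy (hδ y) hq (hmom y) (hκq y) hM
    rw [← hκ ℓ y, hcast] at h
    exact h
  rw [mul_assoc]
  generalize (M₀ * 2 ^ ℓ : ℝ) = M at hMr hcond ⊢
  have hMpos : 0 < M := by linarith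
  have hr1 : 1 ≤ √M := Real.one_le_sqrt.2 hMr
  have hr0 : 0 < √M := by linarith
  have hrr : √M * √M = M := Real.mul_self_sqrt hMpos.le
  constructor
  · rw [Measure.lintegral_compProd (by fun_prop)]
    calc _ ≤ ∫⁻ y, ENNReal.ofReal (C / √M) *
            ENNReal.ofReal (s y * ((1 + √M * δ y) ^ (-(min 3 q - 1)) + 0)) ∂ν := by
          refine lintegral_mono_ae (hspos.mono fun y hy => (hcond y hy).1.trans_eq ?_)
          rw [← ENNReal.ofReal_mul (by positivity)]
          congr 1
          rw [hC]; ring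
      _ ≤ ENNReal.ofReal (C / √M) * ENNReal.ofReal
            (|σ₀| * (ρ₀ * ((√M)⁻¹ * J₁) + 0) + (1 / (√M * δ₀) + 0) * V₁) := by
          rw [lintegral_const_mul _ (by fun_prop)]
          gcongr
          exact lintegral_weighted_rpow_le hδ0 hδmeas hρ₀ hδ₀ hdensity hρbound (by linarith)
            hr0 le_rfl hs0 hsint (abs_nonneg _) hW
      _ = ENNReal.ofReal (c₁ / M) := by
          rw [← ENNReal.ofReal_mul (by positivity)]
          congr 1
          rw [hc₁]
          conv_rhs => rw [← hrr]
          field_simp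
          ring
      _ ≤ _ := by
          apply ENNReal.ofReal_le_ofReal
          rw [← div_eq_mul_inv, div_le_div_iff₀ hMpos (by positivity)]
          nlinarith [mul_nonneg hc₂0 hMpos.le]
  · rw [Measure.lintegral_compProd (by fun_prop)]
    have hb0 : 0 ≤ √M ^ (2 - min 3 q) := by positivity
    have hb1 : (√M)⁻¹ ≤ √M ^ (2 - min 3 q) := by
      rw [← Real.rpow_neg_one]
      exact Real.rpow_le_rpow_of_exponent_le hr1 (by linarith)
    have hpow : √M ^ (2 - min 3 q) / M = M ^ (-(min 3 q) / 2) := by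
      rw [Real.sqrt_eq_rpow, ← Real.rpow_mul hMpos.le, div_eq_mul_inv, ← Real.rpow_neg_one M,
        ← Real.rpow_add hMpos]
      ring_nf
    calc _ ≤ ∫⁻ y, ENNReal.ofReal (C / M) *
            ENNReal.ofReal (s y ^ 2 * ((1 + √M * δ y) ^ (-2 : ℝ) + √M ^ (2 - min 3 q))) ∂ν := by
          refine lintegral_mono_ae (hspos.mono fun y hy => (hcond y hy).2.trans_eq ?_)
          rw [← ENNReal.ofReal_mul (by positivity)]
          congr 1
          rw [hC]; ring
      _ ≤ ENNReal.ofReal (C / M) * ENNReal.ofReal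
            (|σ₀| ^ 2 * (ρ₀ * ((√M)⁻¹ * J₂) + √M ^ (2 - min 3 q))
              + (1 / (√M * δ₀) + √M ^ (2 - min 3 q)) * V₂) := by
          rw [lintegral_const_mul _ (by fun_prop)]
          gcongr
          exact lintegral_weighted_rpow_le hδ0 hδmeas hρ₀ hδ₀ hdensity hρbound one_lt_two
            hr0 hb0 (fun y => sq_nonneg _) hσ2 (by positivity)
            fun y hy => pow_le_pow_left₀ (hs0 y) (hW y hy) 2
      _ ≤ ENNReal.ofReal (c₂ * M ^ (-(min 3 q) / 2)) := by
          rw [← ENNReal.ofReal_mul (by positivity), ← hpow]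
          apply ENNReal.ofReal_le_ofReal
          have h1 : 1 / (√M * δ₀) = (√M)⁻¹ * (1 / δ₀) := by field_simp
          rw [h1]
          calc _ ≤ C / M * (|σ₀| ^ 2 * (ρ₀ * (√M ^ (2 - min 3 q) * J₂) + √M ^ (2 - min 3 q))
                + (√M ^ (2 - min 3 q) * (1 / δ₀) + √M ^ (2 - min 3 q)) * V₂) := by gcongr
            _ = _ := by rw [hc₂]; ring
      _ ≤ _ := by
          apply ENNReal.ofReal_le_ofReal
          rw [Real.mul_rpow (by norm_num) hMpos.le]
          have h2 : (1 / 4 : ℝ) ≤ 2 ^ (-(min 3 q) / 2) := by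
            calc (1 / 4 : ℝ) = 2 ^ (-2 : ℝ) := by
                  rw [Real.rpow_neg (by norm_num)]; norm_num
              _ ≤ _ := Real.rpow_le_rpow_of_exponent_le (by norm_num) (by linarith)
          rw [← mul_assoc]
          gcongr
          nlinarith
end

section
/- For all real numbers x₁, x₂, the function f(x₁,x₂) := max(0, (x₁+x₂)/2) − (1/2)·max(0,x₁) − (1/2)·max(0,x₂) satisfies: (i) f(x₁,x₂) = (1/4)·(|x₁+x₂| − |x₁| − |x₂|); (ii) f(x₁,x₂) ≤ 0; (iii) |f(x₁,x₂)| ≤ (1/2)·|x₁−x₂|, and consequently |f(x₁,x₂)| ≤ (1/2)·(|x₁−x| + |x₂−x|) for any real x; and (iv) f(x₁,x₂) = 0 whenever x₁ and x₂ have the same sign (both ≥ 0 or both ≤ 0). -/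
theorem max_zero_eq_half_add_abs (x : ℝ) : max 0 x = (x + |x|) / 2 := by
  rcases le_total 0 x with h | h
  · rw [max_eq_right h, abs_of_nonneg h]; ring
  · rw [max_eq_left h, abs_of_nonpos h]; ring

theorem abs_add_abs_le_abs_add_add_abs_sub (x y : ℝ) : |x| + |y| ≤ |x + y| + |x - y| := by
  rcases abs_cases x with hx | hx <;> rcases abs_cases y with hy | hy <;>
    linarith [le_abs_self (x + y), neg_le_abs (x + y), le_abs_self (x - y), neg_le_abs (x - y),
      abs_nonneg (x + y), abs_nonneg (x - y)]

/-- Structural properties of the antithetic-difference function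
`f(x₁,x₂) = max(0,(x₁+x₂)/2) − (1/2)max(0,x₁) − (1/2)max(0,x₂)`. -/
theorem antithetic_max_identity (x₁ x₂ : ℝ) :
    (max 0 ((x₁ + x₂) / 2) - (1 / 2) * max 0 x₁ - (1 / 2) * max 0 x₂
        = (1 / 4) * (|x₁ + x₂| - |x₁| - |x₂|)) ∧
    (max 0 ((x₁ + x₂) / 2) - (1 / 2) * max 0 x₁ - (1 / 2) * max 0 x₂ ≤ 0) ∧
    (|max 0 ((x₁ + x₂) / 2) - (1 / 2) * max 0 x₁ - (1 / 2) * max 0 x₂|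
        ≤ (1 / 2) * |x₁ - x₂|) ∧
    (∀ x : ℝ, |max 0 ((x₁ + x₂) / 2) - (1 / 2) * max 0 x₁ - (1 / 2) * max 0 x₂|
        ≤ (1 / 2) * (|x₁ - x| + |x₂ - x|)) ∧
    ((0 ≤ x₁ ∧ 0 ≤ x₂) ∨ (x₁ ≤ 0 ∧ x₂ ≤ 0) →
      max 0 ((x₁ + x₂) / 2) - (1 / 2) * max 0 x₁ - (1 / 2) * max 0 x₂ = 0) := by
  have identity : max 0 ((x₁ + x₂) / 2) - (1 / 2) * max 0 x₁ - (1 / 2) * max 0 x₂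
      = (1 / 4) * (|x₁ + x₂| - |x₁| - |x₂|) := by
    simp only [max_zero_eq_half_add_abs, abs_div, abs_two]
    ring
  have triangle := abs_add_le x₁ x₂
  have bound : |(1 / 4) * (|x₁ + x₂| - |x₁| - |x₂|)| ≤ (1 / 2) * |x₁ - x₂| := by
    rw [abs_of_nonpos (by linarith)]
    linarith [abs_add_abs_le_abs_add_add_abs_sub x₁ x₂, abs_nonneg (x₁ - x₂)]
  rw [identity]
  refine ⟨rfl, by linarith, bound, fun x => ?_, ?_⟩
  · have := abs_sub_le x₁ x x₂
    rw [abs_sub_comm x x₂] at this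
    linarith
  · rintro (⟨h₁, h₂⟩ | ⟨h₁, h₂⟩)
    · rw [abs_of_nonneg h₁, abs_of_nonneg h₂, abs_of_nonneg (add_nonneg h₁ h₂)]; ring
    · rw [abs_of_nonpos h₁, abs_of_nonpos h₂, abs_of_nonpos (add_nonpos h₁ h₂)]; ring
end

section
/- Let L be an integrable real random variable, η ∈ (0,1), and define f(x) = x + η^{-1}·E[max(L−x, 0)]. Then f is convex on ℝ, and if L_η satisfies P(L > L_η) = η and P(L = L_η) = 0, then f(L_η) = E[L | L > L_η] and f(L_η) = inf over x ∈ ℝ of f(x). -/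
open MeasureTheory ProbabilityTheory

/-- The positive part of a shifted integrable function is integrable. -/
lemma integrable_max_sub_const {Ω : Type*} [MeasurableSpace Ω] {P : Measure Ω}
    [IsFiniteMeasure P] {L : Ω → ℝ} (hL : Integrable L P) (x : ℝ) :
    Integrable (fun ω => max (L ω - x) 0) P :=
  (hL.sub (integrable_const x)).pos_part

lemma convexOn_integral_max_sub {Ω : Type*} [MeasurableSpace Ω] {P : Measure Ω}
    [IsFiniteMeasure P] {L : Ω → ℝ} (hL : Integrable L P) :
    ConvexOn ℝ Set.univ (fun x : ℝ => ∫ ω, max (L ω - x) 0 ∂P) := by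
  refine ⟨convex_univ, fun x _ y _ a b ha hb hab => ?_⟩
  have hx := (integrable_max_sub_const hL x).const_mul a
  have hy := (integrable_max_sub_const hL y).const_mul b
  simp only [smul_eq_mul]
  rw [← integral_const_mul, ← integral_const_mul, ← integral_add hx hy]
  refine integral_mono (integrable_max_sub_const hL _) (hx.add hy) fun ω => ?_
  have hLab : L ω = a * L ω + b * L ω := by rw [← add_mul, hab, one_mul]
  have h₁ := mul_le_mul_of_nonneg_left (le_max_left (L ω - x) 0) ha
  have h₂ := mul_le_mul_of_nonneg_left (le_max_left (L ω - y) 0) hb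
  have h₃ := mul_nonneg ha (le_max_right (L ω - x) 0)
  have h₄ := mul_nonneg hb (le_max_right (L ω - y) 0)
  exact max_le (by linarith) (by linarith)

lemma setIntegral_sub_const_le_integral_max {Ω : Type*} [MeasurableSpace Ω] {P : Measure Ω}
    [IsFiniteMeasure P] {L : Ω → ℝ} (hL : Integrable L P) (s : Set Ω) (x : ℝ) :
    ∫ ω in s, (L ω - x) ∂P ≤ ∫ ω, max (L ω - x) 0 ∂P :=
  (integral_mono (hL.sub (integrable_const x)).integrableOn
    (integrable_max_sub_const hL x).integrableOn fun _ => le_max_left _ _).trans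
    (setIntegral_le_integral (integrable_max_sub_const hL x)
      (Filter.Eventually.of_forall fun _ => le_max_right _ _))

lemma integral_max_sub_eq_setIntegral {Ω : Type*} [MeasurableSpace Ω] {P : Measure Ω}
    {L : Ω → ℝ} (hL : AEMeasurable L P) (x : ℝ) :
    ∫ ω, max (L ω - x) 0 ∂P = ∫ ω in {ω | x < L ω}, (L ω - x) ∂P := by
  rw [← integral_indicator₀ (nullMeasurableSet_lt aemeasurable_const hL)]
  congr 1 with ω
  by_cases h : x < L ω
  · rw [Set.indicator_of_mem (by exact h), max_eq_left (sub_pos.2 h).le]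
  · rw [Set.indicator_of_notMem (by exact h), max_eq_right (sub_nonpos.2 (not_lt.1 h))]

/-- CVaR as the Rockafellar–Uryasev minimum: for an integrable loss
`L`, `η ∈ (0,1)`, and `f(x) = x + η⁻¹·E[max(L−x,0)]`, the function `f` is convex; and if
`L_η` satisfies `P(L > L_η) = η` and `P(L = L_η) = 0`, then
`f(L_η) = E[L | L > L_η]` and `f(L_η) = inf_x f(x)`. -/
theorem cvar_rockafellar {Ω : Type*} [MeasurableSpace Ω]
    (P : Measure Ω) [IsProbabilityMeasure P]
    (L : Ω → ℝ) (hL : Integrable L P)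
    (η : ℝ) (hη0 : 0 < η) (hη1 : η < 1)
    (f : ℝ → ℝ) (hf : ∀ x, f x = x + η⁻¹ * ∫ ω, max (L ω - x) 0 ∂P) :
    ConvexOn ℝ Set.univ f ∧
      ∀ Lη : ℝ, P {ω | Lη < L ω} = ENNReal.ofReal η → P {ω | L ω = Lη} = 0 →
        f Lη = ∫ ω, L ω ∂(ProbabilityTheory.cond P {ω | Lη < L ω}) ∧
        f Lη = ⨅ x : ℝ, f x := by
  obtain rfl : f = fun x => x + η⁻¹ * ∫ ω, max (L ω - x) 0 ∂P := funext hf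
  refine ⟨(convexOn_id convex_univ).add
    ((convexOn_integral_max_sub hL).smul (inv_nonneg.2 hη0.le)), fun Lη hP _ => ?_⟩
  have hsub (x : ℝ) : ∫ ω in {ω | Lη < L ω}, (L ω - x) ∂P
      = ∫ ω in {ω | Lη < L ω}, L ω ∂P - η * x := by
    rw [integral_sub hL.integrableOn (integrable_const x), setIntegral_const, measureReal_def,
      hP, ENNReal.toReal_ofReal hη0.le, smul_eq_mul]
  have hshift (x I : ℝ) : x + η⁻¹ * (I - η * x) = η⁻¹ * I := by
    field_simp
    ring
  have hmin (x : ℝ) : Lη + η⁻¹ * ∫ ω, max (L ω - Lη) 0 ∂P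
      ≤ x + η⁻¹ * ∫ ω, max (L ω - x) 0 ∂P := by
    rw [integral_max_sub_eq_setIntegral hL.aemeasurable Lη, hsub, hshift, ← hshift x, ← hsub]
    gcongr
    exact setIntegral_sub_const_le_integral_max hL _ x
  refine ⟨?_, le_antisymm (le_ciInf hmin) (ciInf_le ⟨_, Set.forall_mem_range.2 hmin⟩ Lη)⟩
  simp only [integral_max_sub_eq_setIntegral hL.aemeasurable Lη, hsub, hshift]
  rw [ProbabilityTheory.cond, integral_smul_measure, hP, ENNReal.toReal_inv,
    ENNReal.toReal_ofReal hη0.le, smul_eq_mul]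
end
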